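/- Let A be a Cohen–Macaulay local ring and let M and N be nonzero finitely generated Tor-independent A-modules. If M has reducible complexity and N has finite Gorenstein dimension, then depth M + depth N = dim A + depth (M ⊗_A N). -/

import Mathlib

open IsLocalRing CategoryTheory

universe u

noncomputable section

/-! Basic commutative-algebra notions: depth, minimal free resolutions, Betti numbers,
complexity, syzygies, reducible complexity, upper reducing degree, Tor-independence,
Gorenstein dimension, CI-dimension, Cohen-Macaulay local rings. -/




/-- The depth of a module over a local ring: the supremum of lengths of regular
sequences on the module consisting of elements of the maximal ideal. -/
def moduleDepth (A : Type u) [CommRing A] [IsLocalRing A]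
    (M : Type u) [AddCommGroup M] [Module A M] : ℕ∞ :=
  sSup {n : ℕ∞ | ∃ rs : List A, (rs.length : ℕ∞) = n ∧
    (∀ x ∈ rs, x ∈ maximalIdeal A) ∧ RingTheory.Sequence.IsRegular M rs}

/-- A minimal free resolution of a module over a local ring. -/
structure MinFreeRes (A : Type u) [CommRing A] [IsLocalRing A]
    (M : Type u) [AddCommGroup M] [Module A M] : Type (u + 1) where
  F : ℕ → ModuleCat.{u} A
  free : ∀ n, Module.Free A (F n)
  fin : ∀ n, Module.Finite A (F n)
  d : ∀ n, F (n + 1) →ₗ[A] F n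
  aug : F 0 →ₗ[A] M
  aug_surj : Function.Surjective aug
  exact_aug : Function.Exact (d 0) aug
  exact_d : ∀ n, Function.Exact (d (n + 1)) (d n)
  minimal : ∀ n x, d n x ∈ (maximalIdeal A) • (⊤ : Submodule A (F n))

/-- The Betti numbers of a minimal free resolution. -/
def MinFreeRes.betti {A : Type u} [CommRing A] [IsLocalRing A]
    {M : Type u} [AddCommGroup M] [Module A M] (R : MinFreeRes A M) (n : ℕ) : ℕ :=
  Module.finrank A (R.F n)

/-- The sequence `β` is eventually bounded by `a * n ^ (t - 1)` for some real `a`. -/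
def CxBound (β : ℕ → ℕ) (t : ℕ) : Prop :=
  ∃ a : ℝ, ∃ N : ℕ, ∀ n, N ≤ n → (β n : ℝ) ≤ a * (n : ℝ) ^ ((t : ℝ) - 1)

/-- The complexity of a module: the least `t` such that the Betti sequence of a minimal
free resolution is eventually bounded by `a * n ^ (t - 1)` for some `a` (and `⊤` if no
such `t` exists). -/
def complexity (A : Type u) [CommRing A] [IsLocalRing A]
    (M : Type u) [AddCommGroup M] [Module A M] : ℕ∞ :=
  sInf {t : ℕ∞ | ∃ t' : ℕ, t = (t' : ℕ∞) ∧ ∃ R : MinFreeRes A M, CxBound R.betti t'}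

/-- A finite resolution of a module `M`:
an exact sequence `0 → G len → ⋯ → G 0 → M → 0`. -/
structure FinRes (A : Type u) [CommRing A]
    (M : Type u) [AddCommGroup M] [Module A M] : Type (u + 1) where
  len : ℕ
  G : ℕ → ModuleCat.{u} A
  d : ∀ n, G (n + 1) →ₗ[A] G n
  aug : G 0 →ₗ[A] M
  bounded : ∀ n, len < n → Subsingleton (G n)
  aug_surj : Function.Surjective aug
  exact_aug : Function.Exact (d 0) aug
  exact_d : ∀ n, Function.Exact (d (n + 1)) (d n)

/-- A module has finite projective dimension if it admits a finite resolution by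
projective modules. -/
def HasFiniteProjDim (A : Type u) [CommRing A]
    (M : Type u) [AddCommGroup M] [Module A M] : Prop :=
  ∃ R : FinRes A M, ∀ n, Module.Projective A (R.G n)

/-- `S` is an `n`-th syzygy of `M`: for `n = 0`, `S ≅ M`; for `n ≥ 1`, `S` is isomorphic to
the image of the `n`-th differential in a minimal free resolution of `M`. -/
def IsSyzygy (A : Type u) [CommRing A] [IsLocalRing A]
    (M : Type u) [AddCommGroup M] [Module A M]
    (S : Type u) [AddCommGroup S] [Module A S] : ℕ → Prop
  | 0 => Nonempty (S ≃ₗ[A] M)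
  | (n + 1) => ∃ R : MinFreeRes A M, Nonempty (S ≃ₗ[A] LinearMap.range (R.d n))

/-- `K` is obtained from `M` by a reduction of complexity coming from a cohomology class
of degree `t ≥ 1`, i.e. there is a short exact sequence `0 → M → K → Ω^{t-1}(M) → 0`. -/
def ReducesWithDeg (A : Type u) [CommRing A] [IsLocalRing A]
    (M K : ModuleCat.{u} A) (t : ℕ) : Prop :=
  1 ≤ t ∧ ∃ (S : Type u) (_ : AddCommGroup S) (_ : Module A S),
    IsSyzygy A M S (t - 1) ∧
    ∃ (f : M →ₗ[A] K) (g : K →ₗ[A] S),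
      Function.Injective f ∧ Function.Surjective g ∧ Function.Exact f g

/-- The class of (bundled) modules having reducible complexity: the smallest class
containing all modules of finite projective dimension, and containing every module `M` of
finite positive complexity admitting a short exact sequence
`0 → M → K → Ω^{t-1}(M) → 0` (coming from a degree-`t` self-extension) with
`cx K < cx M` and `K` of reducible complexity. -/
inductive HasRedCxCat (A : Type u) [CommRing A] [IsLocalRing A] : ModuleCat.{u} A → Prop
  | of_finite_pd (M : ModuleCat.{u} A) : HasFiniteProjDim A M → HasRedCxCat A M
  | of_step (M K : ModuleCat.{u} A) (t : ℕ) :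
      complexity A M ≠ 0 → complexity A M ≠ ⊤ →
      ReducesWithDeg A M K t →
      complexity A K < complexity A M →
      HasRedCxCat A K → HasRedCxCat A M

/-- A module has reducible complexity. -/
def HasReducibleComplexity (A : Type u) [CommRing A] [IsLocalRing A]
    (M : Type u) [AddCommGroup M] [Module A M] : Prop :=
  HasRedCxCat A (ModuleCat.of A M)

/-- A sequence of short exact sequences `0 → K_{i-1} → K_i → Ω^{d_i - 1}(K_{i-1}) → 0`
with strictly decreasing complexities, ending in a module of complexity zero, i.e. a
sequence reducing the complexity of `Ks 0`. -/
def IsReducingSeq (A : Type u) [CommRing A] [IsLocalRing A] (t : ℕ)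
    (Ks : Fin (t + 1) → ModuleCat.{u} A) (degs : Fin t → ℕ) : Prop :=
  (∀ i : Fin t, ReducesWithDeg A (Ks i.castSucc) (Ks i.succ) (degs i)) ∧
  (∀ i : Fin t, complexity A (Ks i.succ) < complexity A (Ks i.castSucc)) ∧
  complexity A (Ks (Fin.last t)) = 0

open Classical in
/-- The upper reducing degree of `M`: `⊤` if `M` has finite projective dimension, and
otherwise the supremum, over all sequences reducing the complexity of `M`, of the minimum
of the degrees of the cohomology classes involved. -/
def upperReducingDegree (A : Type u) [CommRing A] [IsLocalRing A]
    (M : Type u) [AddCommGroup M] [Module A M] : ℕ∞ :=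
  if HasFiniteProjDim A M then ⊤
  else sSup {r : ℕ∞ | ∃ (t : ℕ) (Ks : Fin (t + 1) → ModuleCat.{u} A) (degs : Fin t → ℕ),
    Ks 0 = ModuleCat.of A M ∧ IsReducingSeq A t Ks degs ∧
    r = ⨅ i : Fin t, (degs i : ℕ∞)}

/-- The `n`-th Tor module of two modules. -/
def torModule (A : Type u) [CommRing A] (M N : Type u)
    [AddCommGroup M] [Module A M] [AddCommGroup N] [Module A N] (n : ℕ) : ModuleCat.{u} A :=
  ((Tor (ModuleCat.{u} A) n).obj (ModuleCat.of A M)).obj (ModuleCat.of A N)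

/-- Two modules are Tor-independent if `Tor_n(M, N) = 0` for all `n > 0`. -/
def TorIndep (A : Type u) [CommRing A] (M N : Type u)
    [AddCommGroup M] [Module A M] [AddCommGroup N] [Module A N] : Prop :=
  ∀ n : ℕ, 0 < n → Subsingleton (torModule A M N n)

/-- The `n`-th Ext module of two modules. -/
def extModule (A : Type u) [CommRing A] (M N : Type u)
    [AddCommGroup M] [Module A M] [AddCommGroup N] [Module A N] (n : ℕ) : ModuleCat.{u} A :=
  ((Ext A (ModuleCat.{u} A) n).obj (Opposite.op (ModuleCat.of A M))).obj (ModuleCat.of A N)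

/-- A module `G` has Gorenstein dimension zero if it is reflexive and
`Ext^n(G, A) = 0 = Ext^n(Hom(G, A), A)` for all `n > 0`. -/
def GDimZero (A : Type u) [CommRing A] (G : Type u) [AddCommGroup G] [Module A G] : Prop :=
  Module.IsReflexive A G ∧
  ∀ n : ℕ, 0 < n →
    Subsingleton (extModule A G A n) ∧ Subsingleton (extModule A (Module.Dual A G) A n)

/-- A module has finite Gorenstein dimension if it admits a finite resolution by modules
of Gorenstein dimension zero. -/
def HasFiniteGDim (A : Type u) [CommRing A]
    (M : Type u) [AddCommGroup M] [Module A M] : Prop :=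
  ∃ R : FinRes A M, ∀ n, GDimZero A (R.G n)


/-- The Krull dimension of a ring, viewed in `WithBot ℕ∞`. -/
def ringKrullDimE (A : Type u) [CommRing A] : WithBot ℕ∞ := ringKrullDim A

/-- A local ring is Cohen-Macaulay if its depth equals its Krull dimension. -/
def IsCMLocalRing (A : Type u) [CommRing A] [IsLocalRing A] : Prop :=
  (moduleDepth A A : WithBot ℕ∞) = ringKrullDimE A

/-- A module over a local ring is maximal Cohen-Macaulay if its depth equals the Krull
dimension of the ring. -/
def IsMaxCM (A : Type u) [CommRing A] [IsLocalRing A]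
    (M : Type u) [AddCommGroup M] [Module A M] : Prop :=
  (moduleDepth A M : WithBot ℕ∞) = ringKrullDimE A

/-- A local ring is Gorenstein if and only if every finitely generated module over it has
finite Gorenstein dimension. -/
def IsGorensteinLocalRing (A : Type u) [CommRing A] [IsLocalRing A] : Prop :=
  ∀ M : ModuleCat.{u} A, Module.Finite A M → HasFiniteGDim A M

/-- A module `M` over a local ring `A` has finite CI-dimension if there is a diagram of
local ring homomorphisms `A → R ← Q` with `A → R` flat and `Q → R` surjective with kernel
generated by a regular sequence, such that `R ⊗_A M` has finite projective dimension
over `Q`. -/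
def HasFiniteCIDimMod (A : Type u) [CommRing A] [IsLocalRing A]
    (M : Type u) [AddCommGroup M] [Module A M] : Prop :=
  ∃ (R Q : Type u) (_ : CommRing R) (_ : CommRing Q) (_ : IsLocalRing R) (_ : IsLocalRing Q)
    (f : A →+* R) (g : Q →+* R),
    IsLocalHom f ∧ IsLocalHom g ∧ Function.Surjective g ∧
    (∃ rs : List Q, RingTheory.Sequence.IsRegular Q rs ∧
      RingHom.ker g = Ideal.span {x | x ∈ rs}) ∧
    (letI : Algebra A R := f.toAlgebra
     Module.Flat A R ∧
     (letI : Module Q (TensorProduct A R M) := Module.compHom _ g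
      HasFiniteProjDim Q (TensorProduct A R M)))


/-! ### Short exact sequences and vanishing of Ext -/

/-- A short exact sequence of modules, given by its two maps. -/
structure IsSES {A : Type u} [CommRing A] {X Y Z : Type u} [AddCommGroup X] [Module A X]
    [AddCommGroup Y] [Module A Y] [AddCommGroup Z] [Module A Z]
    (f : X →ₗ[A] Y) (g : Y →ₗ[A] Z) : Prop where
  inj : Function.Injective f
  exact : Function.Exact f g
  surj : Function.Surjective g

/-- The vanishing of `Ext^n(X, Y)`. -/
abbrev ExtVanish (A : Type u) [CommRing A] (X Y : Type u) [AddCommGroup X] [Module A X]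
    [AddCommGroup Y] [Module A Y] (n : ℕ) : Prop :=
  Subsingleton (Abelian.Ext (ModuleCat.of A X) (ModuleCat.of A Y) n)

section ExtVanish

variable {A : Type u} [CommRing A]
  {W : Type u} [AddCommGroup W] [Module A W]
  {X : Type u} [AddCommGroup X] [Module A X]
  {Y : Type u} [AddCommGroup Y] [Module A Y]
  {Z : Type u} [AddCommGroup Z] [Module A Z]

theorem IsSES.of_ker {g : Y →ₗ[A] Z} (hg : Function.Surjective g) :
    IsSES (LinearMap.ker g).subtype g :=
  ⟨Subtype.val_injective, fun y => by simp, hg⟩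

theorem IsSES.of_range {f : X →ₗ[A] Y} (hf : Function.Injective f) :
    IsSES f (LinearMap.range f).mkQ :=
  ⟨hf, fun y => by simp, Submodule.mkQ_surjective _⟩

theorem IsSES.comp_eq_zero {f : X →ₗ[A] Y} {g : Y →ₗ[A] Z} (h : IsSES f g) : g ∘ₗ f = 0 :=
  h.exact.linearMap_comp_eq_zero

/-- The short complex attached to a short exact sequence. -/
abbrev IsSES.complex {f : X →ₗ[A] Y} {g : Y →ₗ[A] Z} (h : IsSES f g) :
    ShortComplex (ModuleCat.{u} A) :=
  ShortComplex.mk (ModuleCat.ofHom f) (ModuleCat.ofHom g)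
    (by rw [← ModuleCat.ofHom_comp, h.comp_eq_zero]; rfl)

theorem IsSES.shortExact {f : X →ₗ[A] Y} {g : Y →ₗ[A] Z} (h : IsSES f g) :
    h.complex.ShortExact :=
  ModuleCat.shortComplex_shortExact _ h.exact h.inj h.surj

theorem extVanish_of_forall_eq_zero {n : ℕ}
    (h : ∀ x : Abelian.Ext (ModuleCat.of A X) (ModuleCat.of A Y) n, x = 0) : ExtVanish A X Y n :=
  ⟨fun a b => (h a).trans (h b).symm⟩

theorem extVanish_of_retract_right {n : ℕ} (i : Y →ₗ[A] Z) (r : Z →ₗ[A] Y)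
    (hri : r ∘ₗ i = LinearMap.id) (h : ExtVanish A X Z n) : ExtVanish A X Y n := by
  refine extVanish_of_forall_eq_zero fun x => ?_
  have h1 : x.comp (Abelian.Ext.mk₀ (ModuleCat.ofHom i)) (add_zero n) = 0 :=
    Subsingleton.elim _ _
  have h2 : (x.comp (Abelian.Ext.mk₀ (ModuleCat.ofHom i)) (add_zero n)).comp
      (Abelian.Ext.mk₀ (ModuleCat.ofHom r)) (add_zero n) = x := by
    rw [Abelian.Ext.comp_assoc_of_third_deg_zero, Abelian.Ext.mk₀_comp_mk₀,
      ← ModuleCat.ofHom_comp, hri]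
    exact Abelian.Ext.comp_mk₀_id x
  rw [← h2, h1, Abelian.Ext.zero_comp]

theorem extVanish_of_retract_left {n : ℕ} (i : X →ₗ[A] W) (r : W →ₗ[A] X)
    (hri : r ∘ₗ i = LinearMap.id) (h : ExtVanish A W Y n) : ExtVanish A X Y n := by
  refine extVanish_of_forall_eq_zero fun x => ?_
  have h1 : (Abelian.Ext.mk₀ (ModuleCat.ofHom r)).comp x (zero_add n) = 0 :=
    Subsingleton.elim _ _
  have h2 : (Abelian.Ext.mk₀ (ModuleCat.ofHom i)).comp
      ((Abelian.Ext.mk₀ (ModuleCat.ofHom r)).comp x (zero_add n)) (zero_add n) = x := by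
    rw [Abelian.Ext.mk₀_comp_mk₀_assoc, ← ModuleCat.ofHom_comp, hri]
    exact Abelian.Ext.mk₀_id_comp x
  rw [← h2, h1, Abelian.Ext.comp_zero]

theorem ExtVanish.congr_right {n : ℕ} (e : Y ≃ₗ[A] Z) (h : ExtVanish A X Y n) :
    ExtVanish A X Z n :=
  extVanish_of_retract_right e.symm.toLinearMap e.toLinearMap (by ext; simp) h

theorem ExtVanish.congr_left {n : ℕ} (e : X ≃ₗ[A] W) (h : ExtVanish A X Y n) :
    ExtVanish A W Y n :=
  extVanish_of_retract_left e.symm.toLinearMap e.toLinearMap (by ext; simp) h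

section Covariant

variable {f : X →ₗ[A] Y} {g : Y →ₗ[A] Z} (h : IsSES f g)
include h

theorem IsSES.extVanish_right_mid {n : ℕ} (h₁ : ExtVanish A W X n) (h₃ : ExtVanish A W Z n) :
    ExtVanish A W Y n := by
  refine extVanish_of_forall_eq_zero fun x => ?_
  obtain ⟨y, rfl⟩ := Abelian.Ext.covariant_sequence_exact₂ (ModuleCat.of A W) h.shortExact x
    (h₃.elim _ _)
  rw [h₁.elim y 0, Abelian.Ext.zero_comp]

theorem IsSES.extVanish_right_last {n : ℕ} (h₂ : ExtVanish A W Y n)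
    (h₁ : ExtVanish A W X (n + 1)) : ExtVanish A W Z n := by
  refine extVanish_of_forall_eq_zero fun x => ?_
  obtain ⟨y, rfl⟩ := Abelian.Ext.covariant_sequence_exact₃ (ModuleCat.of A W) h.shortExact x rfl
    (h₁.elim _ _)
  rw [h₂.elim y 0, Abelian.Ext.zero_comp]

/-- If `Ext^{n+1}(W, X) → Ext^{n+1}(W, Y)` is zero and `Ext^n(W, Z)` vanishes, then so does
`Ext^{n+1}(W, X)`. -/
theorem IsSES.extVanish_right_first_of_map {n : ℕ} (h₃ : ExtVanish A W Z n)
    (hf : ∀ x : Abelian.Ext (ModuleCat.of A W) (ModuleCat.of A X) (n + 1),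
      x.comp (Abelian.Ext.mk₀ (ModuleCat.ofHom f)) (add_zero (n + 1)) = 0) :
    ExtVanish A W X (n + 1) := by
  refine extVanish_of_forall_eq_zero fun x => ?_
  obtain ⟨y, rfl⟩ := Abelian.Ext.covariant_sequence_exact₁ (ModuleCat.of A W) h.shortExact x
    (hf x) rfl
  rw [h₃.elim y 0, Abelian.Ext.zero_comp]

theorem IsSES.extVanish_right_first {n : ℕ} (h₃ : ExtVanish A W Z n)
    (h₂ : ExtVanish A W Y (n + 1)) : ExtVanish A W X (n + 1) :=
  h.extVanish_right_first_of_map h₃ fun _ => h₂.elim _ _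

theorem IsSES.extVanish_right_first_zero_of_map
    (hf : ∀ x : Abelian.Ext (ModuleCat.of A W) (ModuleCat.of A X) 0,
      x.comp (Abelian.Ext.mk₀ (ModuleCat.ofHom f)) (add_zero 0) = 0) :
    ExtVanish A W X 0 := by
  refine extVanish_of_forall_eq_zero fun x => ?_
  have : Mono (ModuleCat.ofHom f) := (ModuleCat.mono_iff_injective _).2 h.inj
  exact Abelian.Ext.postcomp_mk₀_injective_of_mono (ModuleCat.of A W) (ModuleCat.ofHom f)
    ((hf x).trans (by simp))

theorem IsSES.exists_lift {φ : W →ₗ[A] Z} (h₁ : ExtVanish A W X 1) :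
    ∃ ψ : W →ₗ[A] Y, g ∘ₗ ψ = φ := by
  obtain ⟨y, hy⟩ := Abelian.Ext.covariant_sequence_exact₃ (ModuleCat.of A W) h.shortExact
    (Abelian.Ext.mk₀ (ModuleCat.ofHom φ)) rfl (h₁.elim _ _)
  obtain ⟨ψ, rfl⟩ := (Abelian.Ext.mk₀_bijective _ _).2 y
  refine ⟨ψ.hom, ?_⟩
  rw [Abelian.Ext.mk₀_comp_mk₀] at hy
  have := (Abelian.Ext.mk₀_bijective _ _).1 hy
  exact congrArg ModuleCat.Hom.hom this

theorem IsSES.extVanish_right_one_of_lift (h₂ : ExtVanish A W Y 1)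
    (hl : ∀ φ : W →ₗ[A] Z, ∃ ψ : W →ₗ[A] Y, g ∘ₗ ψ = φ) : ExtVanish A W X 1 := by
  refine extVanish_of_forall_eq_zero fun x => ?_
  obtain ⟨y, rfl⟩ := Abelian.Ext.covariant_sequence_exact₁ (ModuleCat.of A W) h.shortExact x
    (h₂.elim _ _) (zero_add 1)
  obtain ⟨φ, rfl⟩ := (Abelian.Ext.mk₀_bijective _ _).2 y
  obtain ⟨ψ, hψ⟩ := hl φ.hom
  have e : φ = ModuleCat.ofHom ψ ≫ h.complex.g := by
    ext x; exact (LinearMap.congr_fun hψ x).symm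
  rw [e, ← Abelian.Ext.mk₀_comp_mk₀, Abelian.Ext.comp_assoc_of_second_deg_zero,
    h.shortExact.comp_extClass, Abelian.Ext.comp_zero]

end Covariant

section Contravariant

variable {f : X →ₗ[A] Y} {g : Y →ₗ[A] Z} (h : IsSES f g)
include h

theorem IsSES.extVanish_left_mid {n : ℕ} (h₁ : ExtVanish A X W n) (h₃ : ExtVanish A Z W n) :
    ExtVanish A Y W n := by
  refine extVanish_of_forall_eq_zero fun x => ?_
  obtain ⟨y, rfl⟩ := Abelian.Ext.contravariant_sequence_exact₂ h.shortExact (ModuleCat.of A W) x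
    (h₁.elim _ _)
  rw [h₃.elim y 0, Abelian.Ext.comp_zero]

theorem IsSES.extVanish_left_first {n : ℕ} (h₂ : ExtVanish A Y W n)
    (h₃ : ExtVanish A Z W (n + 1)) : ExtVanish A X W n := by
  refine extVanish_of_forall_eq_zero fun x => ?_
  obtain ⟨y, rfl⟩ := Abelian.Ext.contravariant_sequence_exact₁ h.shortExact (ModuleCat.of A W) x
    (add_comm 1 n) (h₃.elim _ _)
  rw [h₂.elim y 0, Abelian.Ext.comp_zero]

theorem IsSES.extVanish_left_last {n : ℕ} (h₁ : ExtVanish A X W n)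
    (h₂ : ExtVanish A Y W (n + 1)) : ExtVanish A Z W (n + 1) := by
  refine extVanish_of_forall_eq_zero fun x => ?_
  obtain ⟨y, rfl⟩ := Abelian.Ext.contravariant_sequence_exact₃ h.shortExact (ModuleCat.of A W) x
    (h₂.elim _ _) (add_comm 1 n)
  rw [h₁.elim y 0, Abelian.Ext.comp_zero]

theorem IsSES.exists_extension (φ : X →ₗ[A] W) (h₃ : ExtVanish A Z W 1) :
    ∃ ψ : Y →ₗ[A] W, ψ ∘ₗ f = φ := by
  obtain ⟨y, hy⟩ := Abelian.Ext.contravariant_sequence_exact₁ h.shortExact (ModuleCat.of A W)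
    (Abelian.Ext.mk₀ (ModuleCat.ofHom φ)) (add_zero 1) (h₃.elim _ _)
  obtain ⟨ψ, rfl⟩ := (Abelian.Ext.mk₀_bijective _ _).2 y
  refine ⟨ψ.hom, ?_⟩
  rw [Abelian.Ext.mk₀_comp_mk₀] at hy
  have := (Abelian.Ext.mk₀_bijective _ _).1 hy
  exact congrArg ModuleCat.Hom.hom this

theorem IsSES.extVanish_left_one_of_extension (h₂ : ExtVanish A Y W 1)
    (hl : ∀ φ : X →ₗ[A] W, ∃ ψ : Y →ₗ[A] W, ψ ∘ₗ f = φ) : ExtVanish A Z W 1 := by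
  refine extVanish_of_forall_eq_zero fun x => ?_
  obtain ⟨y, rfl⟩ := Abelian.Ext.contravariant_sequence_exact₃ h.shortExact (ModuleCat.of A W) x
    (h₂.elim _ _) (add_zero 1)
  obtain ⟨φ, rfl⟩ := (Abelian.Ext.mk₀_bijective _ _).2 y
  obtain ⟨ψ, hψ⟩ := hl φ.hom
  have e : φ = h.complex.f ≫ ModuleCat.ofHom ψ := by
    ext x; exact (LinearMap.congr_fun hψ x).symm
  rw [e, ← Abelian.Ext.mk₀_comp_mk₀, ← Abelian.Ext.comp_assoc_of_second_deg_zero,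
    h.shortExact.extClass_comp, Abelian.Ext.zero_comp]

end Contravariant

theorem extVanish_of_projective [Module.Projective A X] (n : ℕ) : ExtVanish A X Y (n + 1) := by
  have : Projective (ModuleCat.of A X) := (IsProjective.iff_projective X).1 inferInstance
  exact extVanish_of_forall_eq_zero fun x => Abelian.Ext.eq_zero_of_projective x

end ExtVanish

/-! ### Tor-independence through character modules -/

open TensorProduct

/-- The vanishing of all higher `Tor(M, N)`, expressed as vanishing of `Ext(M, N⁺)` for the
character module `N⁺` of `N`. -/
def TorVanish (A : Type u) [CommRing A] (M N : Type u) [AddCommGroup M] [Module A M]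
    [AddCommGroup N] [Module A N] : Prop :=
  ∀ n : ℕ, ExtVanish A M (CharacterModule N) (n + 1)

section TorVanish

variable {A : Type u} [CommRing A]
  {L : Type u} [AddCommGroup L] [Module A L]
  {F : Type u} [AddCommGroup F] [Module A F]
  {M : Type u} [AddCommGroup M] [Module A M]
  {N : Type u} [AddCommGroup N] [Module A N]
  {X : Type u} [AddCommGroup X] [Module A X]
  {Y : Type u} [AddCommGroup Y] [Module A Y]
  {Z : Type u} [AddCommGroup Z] [Module A Z]

theorem IsSES.dual {f : X →ₗ[A] Y} {g : Y →ₗ[A] Z} (h : IsSES f g) :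
    IsSES (CharacterModule.dual g) (CharacterModule.dual f) := by
  refine ⟨CharacterModule.dual_injective_of_surjective g h.surj, fun c => ?_,
    CharacterModule.dual_surjective_of_injective f h.inj⟩
  constructor
  · intro hc
    have hker : g.toAddMonoidHom.ker ≤ AddMonoidHom.ker c := by
      intro y hy
      obtain ⟨x, rfl⟩ := (h.exact y).1 hy
      exact DFunLike.congr_fun hc x
    refine ⟨AddMonoidHom.liftOfSurjective g.toAddMonoidHom h.surj ⟨c, hker⟩, ?_⟩
    refine DFunLike.ext _ _ fun y => ?_
    exact AddMonoidHom.liftOfRightInverse_comp_apply _ _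
      (Function.rightInverse_surjInv h.surj) ⟨c, hker⟩ y
  · rintro ⟨c, rfl⟩
    refine DFunLike.ext _ _ fun x => ?_
    change c (g (f x)) = 0
    rw [h.exact.apply_apply_eq_zero, map_zero]

theorem extVanish_character_of_flat [Module.Flat A N] (n : ℕ) :
    ExtVanish A X (CharacterModule N) (n + 1) := by
  have : Module.Injective A (CharacterModule N) :=
    Module.Flat.iff_characterModule_injective.1 inferInstance
  have : Injective (ModuleCat.of A (CharacterModule N)) :=
    Module.injective_object_of_injective_module A (CharacterModule N)
  exact extVanish_of_forall_eq_zero fun x => Abelian.Ext.eq_zero_of_injective x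

theorem TorVanish.of_flat_right [Module.Flat A N] : TorVanish A X N :=
  fun n => extVanish_character_of_flat n

theorem exists_character_extension {f : X →ₗ[A] Y} (hf : Function.Injective (f.lTensor M))
    (φ : M →ₗ[A] CharacterModule X) :
    ∃ ψ : M →ₗ[A] CharacterModule Y, CharacterModule.dual f ∘ₗ ψ = φ := by
  obtain ⟨c, hc⟩ := CharacterModule.dual_surjective_of_injective _ hf
    (CharacterModule.homEquiv φ)
  refine ⟨CharacterModule.homEquiv.symm c, ?_⟩
  ext m x
  have := DFunLike.congr_fun hc (m ⊗ₜ x)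
  exact this

theorem extVanish_character_one_of_injective {f : X →ₗ[A] Y} {g : Y →ₗ[A] Z} (h : IsSES f g)
    [Module.Flat A Y] (hf : Function.Injective (f.lTensor M)) :
    ExtVanish A M (CharacterModule Z) 1 :=
  h.dual.extVanish_right_one_of_lift (extVanish_character_of_flat 0)
    (exists_character_extension hf)

theorem IsSES.rTensor {f : X →ₗ[A] Y} {g : Y →ₗ[A] Z} (h : IsSES f g)
    (h₁ : ExtVanish A Z (CharacterModule N) 1) : IsSES (f.rTensor N) (g.rTensor N) := by
  refine ⟨?_, rTensor_exact N h.exact h.surj, LinearMap.rTensor_surjective N h.surj⟩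
  rw [rTensor_injective_iff_lcomp_surjective]
  exact fun φ => h.exists_extension φ h₁

theorem IsSES.lTensor {f : X →ₗ[A] Y} {g : Y →ₗ[A] Z} (h : IsSES f g)
    (h₁ : ExtVanish A M (CharacterModule Z) 1) : IsSES (f.lTensor M) (g.lTensor M) := by
  refine ⟨?_, lTensor_exact M h.exact h.surj, LinearMap.lTensor_surjective M h.surj⟩
  rw [← CharacterModule.dual_surjective_iff_injective]
  intro c
  obtain ⟨ψ, hψ⟩ := h.dual.exists_lift (φ := CharacterModule.homEquiv.symm c) h₁
  refine ⟨CharacterModule.homEquiv ψ, CharacterModule.homEquiv.symm.injective ?_⟩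
  rw [← hψ]
  rfl

theorem lTensor_injective_of_rTensor {f : X →ₗ[A] Y} (h : Function.Injective (f.rTensor M)) :
    Function.Injective (f.lTensor M) := by
  rw [← LinearMap.comm_comp_rTensor_comp_comm_eq]
  simpa using h

/-- Every module has a free cover. -/
theorem exists_free_ses (A : Type u) [CommRing A] (M : Type u) [AddCommGroup M] [Module A M] :
    ∃ (L F : Type u) (_ : AddCommGroup L) (_ : Module A L) (_ : AddCommGroup F) (_ : Module A F)
      (f : L →ₗ[A] F) (g : F →ₗ[A] M), Module.Free A F ∧ IsSES f g :=
  ⟨_, M →₀ A, _, _, _, _, _, _, inferInstance,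
    IsSES.of_ker (g := Finsupp.linearCombination A (id : M → M))
      (Finsupp.linearCombination_id_surjective A M)⟩

theorem TorVanish.of_ses_left {f : L →ₗ[A] F} {g : F →ₗ[A] M} (h : IsSES f g)
    [Module.Projective A F] (hT : TorVanish A M N) : TorVanish A L N :=
  fun n => h.extVanish_left_first (extVanish_of_projective n) (hT (n + 1))

theorem TorVanish.symm (h : TorVanish A M N) : TorVanish A N M := by
  intro n
  induction n generalizing M with
  | zero =>
    obtain ⟨L, F, _, _, _, _, f, g, _, hs⟩ := exists_free_ses A M
    exact extVanish_character_one_of_injective hs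
      (lTensor_injective_of_rTensor (hs.rTensor (h 0)).inj)
  | succ n ih =>
    obtain ⟨L, F, _, _, _, _, f, g, _, hs⟩ := exists_free_ses A M
    exact hs.dual.extVanish_right_first (ih (h.of_ses_left hs))
      (extVanish_character_of_flat (n + 1))

theorem extVanish_character_of_resolution (n : ℕ) :
    ∀ {N : Type u} [AddCommGroup N] [Module A N] (P : ℕ → ModuleCat.{u} A)
      (_ : ∀ n, Module.Flat A (P n)) (d : ∀ n, P (n + 1) →ₗ[A] P n) (aug : P 0 →ₗ[A] N)
      (_ : Function.Surjective aug) (_ : Function.Exact (d 0) aug)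
      (_ : ∀ n, Function.Exact (d (n + 1)) (d n))
      (_ : ∀ n, Function.Exact ((d (n + 1)).lTensor M) ((d n).lTensor M)),
      ExtVanish A M (CharacterModule N) (n + 1) := by
  induction n with
  | zero =>
    intro N _ _ P hP d aug hs h0 hd ht
    have := hP 0
    refine extVanish_character_one_of_injective (IsSES.of_ker hs) ?_
    rw [injective_iff_map_eq_zero]
    intro u hu
    let δ : P 1 →ₗ[A] LinearMap.ker aug :=
      (d 0).codRestrict (LinearMap.ker aug) fun x => h0.apply_apply_eq_zero x
    have hδ : Function.Surjective δ := by
      rintro ⟨x, hx⟩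
      obtain ⟨y, rfl⟩ := (h0 x).1 hx
      exact ⟨y, rfl⟩
    have hd0 : d 0 = (LinearMap.ker aug).subtype ∘ₗ δ := rfl
    obtain ⟨v, rfl⟩ := LinearMap.lTensor_surjective M hδ u
    rw [← LinearMap.comp_apply, ← LinearMap.lTensor_comp, ← hd0] at hu
    obtain ⟨w, rfl⟩ := (ht 0 v).1 hu
    rw [← LinearMap.comp_apply, ← LinearMap.lTensor_comp]
    have : δ ∘ₗ d (0 + 1) = 0 := by
      ext x
      exact (hd 0).apply_apply_eq_zero x
    rw [this, LinearMap.lTensor_zero, LinearMap.zero_apply]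
  | succ n ih =>
    intro N _ _ P hP d aug hs h0 hd ht
    have := hP 0
    refine (IsSES.of_ker hs).dual.extVanish_right_first ?_ (extVanish_character_of_flat (n + 1))
    refine ih (fun n => P (n + 1)) (fun n => hP _) (fun n => d (n + 1))
      ((d 0).codRestrict (LinearMap.ker aug) fun x => h0.apply_apply_eq_zero x) ?_ ?_
      (fun n => hd _) (fun n => ht _)
    · rintro ⟨x, hx⟩
      obtain ⟨y, rfl⟩ := (h0 x).1 hx
      exact ⟨y, rfl⟩
    · intro x
      rw [← hd 0 x, Subtype.ext_iff]
      rfl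

theorem exact_of_projectiveResolution (P : ProjectiveResolution (ModuleCat.of A N)) :
    Function.Surjective (P.π.f 0).hom ∧
    Function.Exact (P.complex.d 1 0).hom (P.π.f 0).hom ∧
    ∀ n, Function.Exact (P.complex.d (n + 2) (n + 1)).hom (P.complex.d (n + 1) n).hom := by
  refine ⟨(ModuleCat.epi_iff_surjective _).1 inferInstance, ?_, fun n => ?_⟩
  · exact (ShortComplex.ShortExact.moduleCat_exact_iff_function_exact _).1 P.exact₀
  · exact (ShortComplex.ShortExact.moduleCat_exact_iff_function_exact _).1 (P.exact_succ n)

theorem TorIndep.torVanish (h : TorIndep A M N) : TorVanish A M N := by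
  intro n
  let P : ProjectiveResolution (ModuleCat.of A N) := ProjectiveResolution.of _
  obtain ⟨h1, h2, h3⟩ := exact_of_projectiveResolution P
  have hP : ∀ n, Module.Flat A (P.complex.X n) := fun n => by
    have : Module.Projective A (P.complex.X n) :=
      (IsProjective.iff_projective (P.complex.X n)).2 (P.projective n)
    infer_instance
  refine extVanish_character_of_resolution n (fun n => P.complex.X n) hP
    (fun n => (P.complex.d (n + 1) n).hom) (P.π.f 0).hom h1 h2 h3 fun m => ?_
  have hT : Subsingleton (torModule A M N (m + 1)) := h (m + 1) m.succ_pos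
  have hz : Limits.IsZero ((((MonoidalCategory.tensoringLeft (ModuleCat.{u} A)).obj
      (ModuleCat.of A M)).leftDerived (m + 1)).obj (ModuleCat.of A N)) :=
    @ModuleCat.isZero_of_subsingleton _ _ _ hT
  have hz' := hz.of_iso (P.isoLeftDerivedObj _ (m + 1)).symm
  have he := (HomologicalComplex.exactAt_iff_isZero_homology _ _).2 hz'
  rw [HomologicalComplex.exactAt_iff' _ (m + 2) (m + 1) m (by simp) (by simp)] at he
  exact (ShortComplex.ShortExact.moduleCat_exact_iff_function_exact _).1 he

end TorVanish

/-! ### Totally reflexive modules -/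

section TotallyReflexive

variable {A : Type u} [CommRing A]
  {F : Type u} [AddCommGroup F] [Module A F]
  {G : Type u} [AddCommGroup G] [Module A G]
  {X : Type u} [AddCommGroup X] [Module A X]
  {Y : Type u} [AddCommGroup Y] [Module A Y]
  {Z : Type u} [AddCommGroup Z] [Module A Z]

theorem extVanish_of_resolution (n : ℕ) :
    ∀ {N : Type u} [AddCommGroup N] [Module A N] (P : ℕ → ModuleCat.{u} A)
      (_ : ∀ n, Module.Projective A (P n)) (d : ∀ n, P (n + 1) →ₗ[A] P n) (aug : P 0 →ₗ[A] N)
      (_ : Function.Surjective aug) (_ : Function.Exact (d 0) aug)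
      (_ : ∀ n, Function.Exact (d (n + 1)) (d n))
      (_ : ∀ n (φ : P (n + 1) →ₗ[A] Y), φ ∘ₗ d (n + 1) = 0 → ∃ ψ : P n →ₗ[A] Y, ψ ∘ₗ d n = φ),
      ExtVanish A N Y (n + 1) := by
  induction n with
  | zero =>
    intro N _ _ P hP d aug hs h0 hd ht
    have := hP 0
    refine (IsSES.of_ker hs).extVanish_left_one_of_extension (extVanish_of_projective 0) fun φ => ?_
    let δ : P (0 + 1) →ₗ[A] LinearMap.ker aug :=
      (d 0).codRestrict (LinearMap.ker aug) fun x => h0.apply_apply_eq_zero x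
    have hδ : δ ∘ₗ d (0 + 1) = 0 := by
      ext x
      exact (hd 0).apply_apply_eq_zero x
    obtain ⟨ψ, hψ⟩ := ht 0 (φ ∘ₗ δ) (by rw [LinearMap.comp_assoc, hδ, LinearMap.comp_zero])
    refine ⟨ψ, ?_⟩
    ext ⟨x, hx⟩
    obtain ⟨y, rfl⟩ := (h0 x).1 hx
    exact LinearMap.congr_fun hψ y
  | succ n ih =>
    intro N _ _ P hP d aug hs h0 hd ht
    have := hP 0
    refine (IsSES.of_ker hs).extVanish_left_last ?_ (extVanish_of_projective (n + 1))
    refine ih (fun n => P (n + 1)) (fun n => hP _) (fun n => d (n + 1))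
      ((d 0).codRestrict (LinearMap.ker aug) fun x => h0.apply_apply_eq_zero x) ?_ ?_
      (fun n => hd _) (fun n => ht _)
    · rintro ⟨x, hx⟩
      obtain ⟨y, rfl⟩ := (h0 x).1 hx
      exact ⟨y, rfl⟩
    · intro x
      rw [← hd 0 x, Subtype.ext_iff]
      rfl

theorem extVanish_of_extModule
    (h : ∀ n : ℕ, 0 < n → Subsingleton (extModule A X Y n)) (n : ℕ) :
    ExtVanish A X Y (n + 1) := by
  let P : ProjectiveResolution (ModuleCat.of A X) := ProjectiveResolution.of _
  obtain ⟨h1, h2, h3⟩ := exact_of_projectiveResolution P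
  refine extVanish_of_resolution n (fun n => P.complex.X n)
    (fun n => (IsProjective.iff_projective (P.complex.X n)).2 (P.projective n))
    (fun n => (P.complex.d (n + 1) n).hom) (P.π.f 0).hom h1 h2 h3 fun m φ hφ => ?_
  have hT : Subsingleton (extModule A X Y (m + 1)) := h (m + 1) m.succ_pos
  have hz : Limits.IsZero (((Ext A (ModuleCat.{u} A) (m + 1)).obj
      (Opposite.op (ModuleCat.of A X))).obj (ModuleCat.of A Y)) :=
    @ModuleCat.isZero_of_subsingleton _ _ _ hT
  have hz' := hz.of_iso (P.isoExt (m + 1) (ModuleCat.of A Y)).symm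
  have he := (HomologicalComplex.exactAt_iff_isZero_homology _ _).2 hz'
  rw [HomologicalComplex.exactAt_iff' _ m (m + 1) (m + 2) (by simp) (by simp)] at he
  have he' := (ShortComplex.ShortExact.moduleCat_exact_iff_function_exact _).1 he
  obtain ⟨ψ, hψ⟩ := (he' (ModuleCat.ofHom φ)).1 (ModuleCat.hom_ext hφ)
  exact ⟨ModuleCat.Hom.hom ψ, congrArg ModuleCat.Hom.hom hψ⟩

/-- Modules of Gorenstein dimension zero, with the vanishing of Ext expressed through
`Abelian.Ext`. -/
structure TotRefl (A : Type u) [CommRing A] (G : Type u) [AddCommGroup G] [Module A G] :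
    Prop where
  reflexive : Module.IsReflexive A G
  ext : ∀ n, ExtVanish A G A (n + 1)
  ext_dual : ∀ n, ExtVanish A (Module.Dual A G) A (n + 1)

theorem GDimZero.totRefl (h : GDimZero A G) : TotRefl A G :=
  ⟨h.1, extVanish_of_extModule fun n hn => (h.2 n hn).1,
    extVanish_of_extModule fun n hn => (h.2 n hn).2⟩

theorem TotRefl.congr (e : X ≃ₗ[A] Y) (h : TotRefl A X) : TotRefl A Y := by
  have := h.reflexive
  exact ⟨Module.equiv e, fun n => (h.ext n).congr_left e,
    fun n => (h.ext_dual n).congr_left e.symm.dualMap⟩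

theorem TotRefl.dual (h : TotRefl A X) : TotRefl A (Module.Dual A X) := by
  have := h.reflexive
  exact ⟨inferInstance, h.ext_dual, fun n => (h.ext n).congr_left (Module.evalEquiv A X)⟩

theorem extVanish_prod_left {n : ℕ} (h₁ : ExtVanish A X Z n) (h₂ : ExtVanish A Y Z n) :
    ExtVanish A (X × Y) Z n :=
  (IsSES.extVanish_left_mid (f := LinearMap.inl A X Y) (g := LinearMap.snd A X Y)
    ⟨LinearMap.inl_injective, .inl_snd, LinearMap.snd_surjective⟩ h₁ h₂)

theorem TotRefl.prod (h₁ : TotRefl A X) (h₂ : TotRefl A Y) : TotRefl A (X × Y) := by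
  have := h₁.reflexive
  have := h₂.reflexive
  exact ⟨inferInstance, fun n => extVanish_prod_left (h₁.ext n) (h₂.ext n),
    fun n => (extVanish_prod_left (h₁.ext_dual n) (h₂.ext_dual n)).congr_left
      (Module.dualProdDualEquivDual A X Y)⟩

theorem TotRefl.of_free [Module.Free A F] [Module.Finite A F] : TotRefl A F :=
  ⟨inferInstance, fun n => extVanish_of_projective n, fun n => extVanish_of_projective n⟩

/-- The dual of a short exact sequence `0 → X → Y → Z → 0` is exact if `Ext¹(Z, A) = 0`. -/
theorem IsSES.dualMap {f : X →ₗ[A] Y} {g : Y →ₗ[A] Z} (h : IsSES f g) (h₁ : ExtVanish A Z A 1) :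
    IsSES g.dualMap f.dualMap := by
  refine ⟨LinearMap.dualMap_injective_of_surjective h.surj, fun φ => ?_,
    fun φ => h.exists_extension φ h₁⟩
  constructor
  · intro hφ
    have hker : LinearMap.ker g ≤ LinearMap.ker φ := by
      intro y hy
      obtain ⟨x, rfl⟩ := (h.exact y).1 hy
      exact LinearMap.congr_fun hφ x
    refine ⟨(LinearMap.ker g).liftQ φ hker ∘ₗ
      (g.quotKerEquivOfSurjective h.surj).symm.toLinearMap, ?_⟩
    ext y
    have : (g.quotKerEquivOfSurjective h.surj).symm (g y) = (LinearMap.ker g).mkQ y := by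
      rw [LinearEquiv.symm_apply_eq]; rfl
    simp [this]
  · rintro ⟨ψ, rfl⟩
    ext x
    simp [h.exact.apply_apply_eq_zero]

theorem TotRefl.of_ses {f : X →ₗ[A] Y} {g : Y →ₗ[A] Z} (h : IsSES f g) (hY : TotRefl A Y)
    (hZ : TotRefl A Z) : TotRefl A X := by
  have := hY.reflexive
  have := hZ.reflexive
  have hd := h.dualMap (hZ.ext 0)
  refine ⟨⟨?_, ?_⟩, fun n => h.extVanish_left_first (hY.ext n) (hZ.ext (n + 1)), fun n => ?_⟩
  · rw [injective_iff_map_eq_zero]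
    intro x hx
    refine h.inj ((Module.bijective_dual_eval A Y).1 ?_)
    rw [map_zero, map_zero]
    ext φ
    exact LinearMap.congr_fun hx (φ ∘ₗ f)
  · intro ξ
    obtain ⟨y, hy⟩ := (Module.bijective_dual_eval A Y).2 (ξ ∘ₗ f.dualMap)
    have hgy : g y = 0 := by
      refine (Module.bijective_dual_eval A Z).1 ?_
      rw [map_zero]
      ext φ
      have h1 : φ (g y) = ξ (f.dualMap (g.dualMap φ)) := LinearMap.congr_fun hy (φ ∘ₗ g)
      rw [hd.exact.apply_apply_eq_zero, map_zero] at h1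
      exact h1
    obtain ⟨x, rfl⟩ := (h.exact y).1 hgy
    refine ⟨x, ?_⟩
    ext φ
    obtain ⟨ψ, rfl⟩ := hd.surj φ
    exact LinearMap.congr_fun hy ψ
  · cases n with
    | zero =>
      refine hd.extVanish_left_one_of_extension (hY.ext_dual 0) fun φ => ?_
      obtain ⟨z, rfl⟩ := (Module.bijective_dual_eval A Z).2 φ
      obtain ⟨y, rfl⟩ := h.surj z
      exact ⟨Module.Dual.eval A Y y, rfl⟩
    | succ n => exact hd.extVanish_left_last (hZ.ext_dual n) (hY.ext_dual (n + 1))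

/-- A finitely generated totally reflexive module embeds into a finite free module with totally
reflexive cokernel. -/
theorem TotRefl.exists_embedding [IsNoetherianRing A] [Module.Finite A X] (h : TotRefl A X) :
    ∃ (F X' : Type u) (_ : AddCommGroup F) (_ : Module A F) (_ : AddCommGroup X')
      (_ : Module A X') (f : X →ₗ[A] F) (g : F →ₗ[A] X'), Module.Free A F ∧ Module.Finite A F ∧
      Module.Finite A X' ∧ TotRefl A X' ∧ IsSES f g := by
  have := h.reflexive
  obtain ⟨r, π, hπ⟩ := Module.Finite.exists_fin' A (Module.Dual A X)
  have hs := (IsSES.of_ker hπ)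
  have hD : TotRefl A (LinearMap.ker π) := TotRefl.of_ses hs TotRefl.of_free h.dual
  have hd := hs.dualMap (h.ext_dual 0)
  refine ⟨Module.Dual A (Fin r → A), Module.Dual A (LinearMap.ker π), _, _, _, _,
    π.dualMap ∘ₗ (Module.evalEquiv A X).toLinearMap, (LinearMap.ker π).subtype.dualMap,
    inferInstance, inferInstance, Module.Finite.of_surjective _ hd.surj, hD.dual, ?_, ?_, hd.surj⟩
  · exact hd.inj.comp (Module.evalEquiv A X).injective
  · intro φ
    rw [hd.exact φ]
    constructor
    · rintro ⟨ξ, rfl⟩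
      exact ⟨(Module.evalEquiv A X).symm ξ,
        congrArg π.dualMap ((Module.evalEquiv A X).apply_symm_apply ξ)⟩
    · rintro ⟨x, rfl⟩
      exact ⟨Module.evalEquiv A X x, rfl⟩

end TotallyReflexive

/-! ### Finite resolutions -/

section Resolutions

variable {A : Type u} [CommRing A]
  {L : Type u} [AddCommGroup L] [Module A L]
  {F : Type u} [AddCommGroup F] [Module A F]
  {M : Type u} [AddCommGroup M] [Module A M]
  {N : Type u} [AddCommGroup N] [Module A N]
  {W : Type u} [AddCommGroup W] [Module A W]
  {X : Type u} [AddCommGroup X] [Module A X]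
  {Y : Type u} [AddCommGroup Y] [Module A Y]
  {Z : Type u} [AddCommGroup Z] [Module A Z]

theorem IsSES.exists_factor {f : X →ₗ[A] Y} {g : Y →ₗ[A] Z} (h : IsSES f g) (φ : W →ₗ[A] Y)
    (hφ : ∀ w, g (φ w) = 0) : ∃ ψ : W →ₗ[A] X, f ∘ₗ ψ = φ := by
  refine ⟨(LinearEquiv.ofInjective f h.inj).symm.toLinearMap ∘ₗ
    φ.codRestrict (LinearMap.range f) fun w => (h.exact _).1 (hφ w), ?_⟩
  ext w
  have := (LinearEquiv.ofInjective f h.inj).apply_symm_apply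
    ⟨φ w, (h.exact _).1 (hφ w)⟩
  exact congrArg Subtype.val this

/-- The left term of a short exact sequence is the kernel of the second map. -/
theorem IsSES.nonempty_equiv_ker {f : X →ₗ[A] Y} {g : Y →ₗ[A] Z} (h : IsSES f g) :
    Nonempty (X ≃ₗ[A] LinearMap.ker g) :=
  ⟨(LinearEquiv.ofInjective f h.inj).trans
    (LinearEquiv.ofEq _ _ h.exact.linearMap_ker_eq.symm)⟩

theorem IsSES.finite_left [IsNoetherianRing A] {f : X →ₗ[A] Y} {g : Y →ₗ[A] W} (h : IsSES f g)
    [Module.Finite A Y] : Module.Finite A X :=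
  Module.Finite.of_injective f h.inj

theorem IsSES.finite_mid {f : X →ₗ[A] Y} {g : Y →ₗ[A] W} (h : IsSES f g)
    [Module.Finite A X] [Module.Finite A W] : Module.Finite A Y := by
  have : Module.Finite A (LinearMap.ker g) := Module.Finite.equiv h.nonempty_equiv_ker.some
  have : Module.Finite A (Y ⧸ LinearMap.ker g) :=
    Module.Finite.equiv (g.quotKerEquivOfSurjective h.surj).symm
  exact Module.Finite.of_submodule_quotient (LinearMap.ker g)

/-- A class of modules which is closed under isomorphisms, kernels of epimorphisms and
binary products, and contains the finite free modules. -/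
structure IsResolving (A : Type u) [CommRing A]
    (C : ∀ (X : Type u) [AddCommGroup X] [Module A X], Prop) : Prop where
  congr : ∀ {X Y : Type u} [AddCommGroup X] [Module A X] [AddCommGroup Y] [Module A Y],
    (X ≃ₗ[A] Y) → C X → C Y
  of_ses : ∀ {X Y Z : Type u} [AddCommGroup X] [Module A X] [AddCommGroup Y] [Module A Y]
    [AddCommGroup Z] [Module A Z] {f : X →ₗ[A] Y} {g : Y →ₗ[A] Z}, IsSES f g → C Y → C Z → C X
  prod : ∀ {X Y : Type u} [AddCommGroup X] [Module A X] [AddCommGroup Y] [Module A Y],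
    C X → C Y → C (X × Y)
  free : ∀ (X : Type u) [AddCommGroup X] [Module A X] [Module.Free A X] [Module.Finite A X], C X

theorem isResolving_totRefl : IsResolving A (TotRefl A) where
  congr := TotRefl.congr
  of_ses := TotRefl.of_ses
  prod := TotRefl.prod
  free _ := TotRefl.of_free

theorem IsSES.projective_left {f : X →ₗ[A] Y} {g : Y →ₗ[A] Z} (h : IsSES f g)
    [Module.Projective A Y] [Module.Projective A Z] : Module.Projective A X := by
  obtain ⟨s, hs⟩ := Module.projective_lifting_property g LinearMap.id h.surj
  obtain ⟨r, hr⟩ := h.exists_factor (LinearMap.id - s ∘ₗ g) fun y => by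
    have := LinearMap.congr_fun hs (g y)
    simp only [LinearMap.comp_apply, LinearMap.id_apply] at this
    simp [this]
  refine Module.Projective.of_split f r ?_
  ext x
  apply h.inj
  have := LinearMap.congr_fun hr (f x)
  simpa [h.exact.apply_apply_eq_zero] using this

theorem isResolving_projective : IsResolving A (fun X _ _ => Module.Projective A X) where
  congr e _ := Module.Projective.of_equiv e
  of_ses h _ _ := h.projective_left
  prod _ _ := inferInstance
  free _ := inferInstance

/-- `ResolutionLE A C n N` means that `N` has a resolution of length at most `n` by modules in the
class `C`. -/
inductive ResolutionLE (A : Type u) [CommRing A]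
    (C : ∀ (X : Type u) [AddCommGroup X] [Module A X], Prop) :
    ℕ → ∀ (N : Type u) [AddCommGroup N] [Module A N], Prop
  | base (N : Type u) [AddCommGroup N] [Module A N] : C N → ResolutionLE A C 0 N
  | step (n : ℕ) (K G N : Type u) [AddCommGroup K] [Module A K] [AddCommGroup G] [Module A G]
      [AddCommGroup N] [Module A N] (f : K →ₗ[A] G) (g : G →ₗ[A] N) :
      C G → ResolutionLE A C n K → IsSES f g → ResolutionLE A C (n + 1) N

variable {C : ∀ (X : Type u) [AddCommGroup X] [Module A X], Prop}

theorem ResolutionLE.congr (hC : IsResolving A C) {n : ℕ} (e : X ≃ₗ[A] Y)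
    (h : ResolutionLE A C n X) : ResolutionLE A C n Y := by
  cases h with
  | base _ h => exact .base _ (hC.congr e h)
  | step n K G _ f g hG hK hs =>
    refine .step n K G Y f (e.toLinearMap ∘ₗ g) hG hK ⟨hs.inj, fun y => ?_, ?_⟩
    · simpa using hs.exact y
    · exact e.surjective.comp hs.surj

theorem resolutionLE_of_bounded (hC : IsResolving A C) (n : ℕ) :
    ∀ {N : Type u} [AddCommGroup N] [Module A N] (G : ℕ → ModuleCat.{u} A)
      (_ : ∀ n, C (G n)) (d : ∀ n, G (n + 1) →ₗ[A] G n) (aug : G 0 →ₗ[A] N)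
      (_ : Function.Surjective aug) (_ : Function.Exact (d 0) aug)
      (_ : ∀ n, Function.Exact (d (n + 1)) (d n))
      (_ : ∀ m, n < m → Subsingleton (G m)), ResolutionLE A C n N := by
  induction n with
  | zero =>
    intro N _ _ G hG d aug hs h0 hd hb
    have : Subsingleton (G 1) := hb 1 one_pos
    have hinj : Function.Injective aug := by
      rw [injective_iff_map_eq_zero]
      intro x hx
      obtain ⟨y, rfl⟩ := (h0 x).1 hx
      rw [show y = 0 from Subsingleton.elim (α := G 1) _ _, map_zero]
    exact .base _ (hC.congr (LinearEquiv.ofBijective aug ⟨hinj, hs⟩) (hG 0))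
  | succ n ih =>
    intro N _ _ G hG d aug hs h0 hd hb
    refine .step n _ _ _ _ _ (hG 0) ?_ (IsSES.of_ker hs)
    refine ih (fun n => G (n + 1)) (fun n => hG _) (fun n => d (n + 1))
      ((d 0).codRestrict (LinearMap.ker aug) fun x => h0.apply_apply_eq_zero x) ?_ ?_
      (fun n => hd _) (fun m hm => hb (m + 1) (Nat.succ_lt_succ hm))
    · rintro ⟨x, hx⟩
      obtain ⟨y, rfl⟩ := (h0 x).1 hx
      exact ⟨y, rfl⟩
    · intro x
      rw [← hd 0 x, Subtype.ext_iff]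
      rfl

theorem HasFiniteProjDim.resolutionLE (h : HasFiniteProjDim A N) :
    ∃ n, ResolutionLE A (fun X _ _ => Module.Projective A X) n N := by
  obtain ⟨R, hR⟩ := h
  exact ⟨R.len, resolutionLE_of_bounded isResolving_projective R.len R.G hR R.d R.aug R.aug_surj
    R.exact_aug R.exact_d R.bounded⟩

theorem HasFiniteGDim.resolutionLE (h : HasFiniteGDim A N) :
    ∃ n, ResolutionLE A (TotRefl A) n N := by
  obtain ⟨R, hR⟩ := h
  exact ⟨R.len, resolutionLE_of_bounded isResolving_totRefl R.len R.G (fun n => (hR n).totRefl)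
    R.d R.aug R.aug_surj R.exact_aug R.exact_d R.bounded⟩

/-- Two short exact sequences ending in the same module, the second with projective middle term,
give a short exact sequence `0 → L → K × F → G → 0`. -/
theorem IsSES.exists_schanuel {K G : Type u} [AddCommGroup K] [Module A K] [AddCommGroup G]
    [Module A G] {f : K →ₗ[A] G} {g : G →ₗ[A] N} (h : IsSES f g) {l : L →ₗ[A] F} {p : F →ₗ[A] N}
    (h' : IsSES l p) [Module.Projective A F] :
    ∃ (a : L →ₗ[A] K × F) (b : K × F →ₗ[A] G), IsSES a b := by
  obtain ⟨s, hs⟩ := Module.projective_lifting_property g p h.surj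
  have hs' : ∀ y, g (s y) = p y := LinearMap.congr_fun hs
  obtain ⟨κ, hκ⟩ := h.exists_factor (-(s ∘ₗ l)) fun x => by
    simp [hs', h'.exact.apply_apply_eq_zero]
  have hκ' : ∀ x, f (κ x) = -(s (l x)) := LinearMap.congr_fun hκ
  refine ⟨κ.prod l, f.coprod s, ⟨fun x y hxy => h'.inj (congrArg Prod.snd hxy), ?_, fun z => ?_⟩⟩
  · rintro ⟨x, y⟩
    constructor
    · intro hxy
      have hxy' : f x + s y = 0 := by simpa using hxy
      have : p y = 0 := by
        have := congrArg g hxy'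
        simpa [hs', h.exact.apply_apply_eq_zero] using this
      obtain ⟨w, rfl⟩ := (h'.exact y).1 this
      refine ⟨w, Prod.ext (h.inj ?_) rfl⟩
      change f (κ w) = f x
      rw [hκ', ← eq_neg_of_add_eq_zero_left hxy']
    · rintro ⟨w, hw⟩
      rw [← hw]
      simp [hκ']
  · obtain ⟨y, hy⟩ := h'.surj (g z)
    obtain ⟨x, hx⟩ := (h.exact (z - s y)).1 (by rw [map_sub, hs', hy, sub_self])
    exact ⟨(x, y), by simp [hx]⟩

theorem ResolutionLE.syzygy (hC : IsResolving A C) {n : ℕ} {l : L →ₗ[A] F} {p : F →ₗ[A] N}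
    (h' : IsSES l p) [Module.Free A F] [Module.Finite A F] (h : ResolutionLE A C (n + 1) N) :
    ResolutionLE A C n L := by
  cases h with
  | step _ K G _ f g hG hK hs =>
    obtain ⟨a, b, hab⟩ := hs.exists_schanuel h'
    cases hK with
    | base _ hK => exact .base _ (hC.of_ses hab (hC.prod hK (hC.free F)) hG)
    | step n K' G' _ f' g' hG' hK' hs' =>
      obtain ⟨e⟩ := hab.nonempty_equiv_ker
      refine ResolutionLE.congr hC e.symm ?_
      let q : G' × F →ₗ[A] K × F := g'.prodMap LinearMap.id
      have hq : Function.Surjective q := by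
        rintro ⟨x, y⟩
        obtain ⟨z, rfl⟩ := hs'.surj x
        exact ⟨(z, y), rfl⟩
      have hbq : Function.Surjective (b ∘ₗ q) := hab.surj.comp hq
      refine .step n K' (LinearMap.ker (b ∘ₗ q)) _
        ((LinearMap.inl A G' F ∘ₗ f').codRestrict _ fun x => ?_)
        ((q ∘ₗ (LinearMap.ker (b ∘ₗ q)).subtype).codRestrict _ fun x => x.2)
        (hC.of_ses (IsSES.of_ker hbq) (hC.prod hG' (hC.free F)) hG) hK' ⟨?_, ?_, ?_⟩
      · have : q (f' x, 0) = 0 := by simp [q, hs'.exact.apply_apply_eq_zero]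
        simp [this]
      · intro x y hxy
        exact hs'.inj (congrArg (fun z => z.1.1) hxy)
      · rintro ⟨⟨x, y⟩, hxy⟩
        constructor
        · intro h0
          have h0' : q (x, y) = 0 := congrArg Subtype.val h0
          have h1 : g' x = 0 := congrArg Prod.fst h0'
          have h2 : y = 0 := congrArg Prod.snd h0'
          obtain ⟨z, rfl⟩ := (hs'.exact x).1 h1
          exact ⟨z, Subtype.ext (Prod.ext rfl h2.symm)⟩
        · rintro ⟨z, hz⟩
          have h1 : f' z = x := congrArg (fun w => w.1.1) hz
          have h2 : 0 = y := congrArg (fun w => w.1.2) hz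
          refine Subtype.ext (Prod.ext ?_ h2.symm)
          change g' x = 0
          rw [← h1, hs'.exact.apply_apply_eq_zero]
      · rintro ⟨x, hx⟩
        obtain ⟨y, rfl⟩ := hq x
        exact ⟨⟨y, hx⟩, rfl⟩

/-- Every finitely generated module over a local ring has a minimal free cover. -/
theorem exists_minimal_cover [IsLocalRing A] [Module.Finite A M] :
    ∃ (r : ℕ) (g : (Fin r → A) →ₗ[A] M), Function.Surjective g ∧
      ∀ v, g v = 0 → ∀ j, v j ∈ maximalIdeal A := by
  classical
  have hex : ∃ r : ℕ, ∃ g : (Fin r → A) →ₗ[A] M, Function.Surjective g :=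
    Module.Finite.exists_fin' A M
  obtain ⟨g, hg⟩ := Nat.find_spec hex
  refine ⟨Nat.find hex, g, hg, fun v hv i => ?_⟩
  by_contra hi
  have hu : IsUnit (v i) := by
    by_contra h
    exact hi ((mem_maximalIdeal _).2 h)
  obtain ⟨u, hu⟩ := hu
  obtain ⟨r', hr'⟩ : ∃ r', Nat.find hex = r' + 1 :=
    Nat.exists_eq_succ_of_ne_zero (Fin.pos i).ne'
  refine Nat.find_min hex (m := r') (by omega) ?_
  generalize Nat.find hex = r at *
  subst hr'
  refine ⟨g ∘ₗ Function.ExtendByZero.linearMap A i.succAbove, fun m => ?_⟩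
  obtain ⟨w, rfl⟩ := hg m
  refine ⟨fun j => (w - (w i * ↑u⁻¹) • v) (i.succAbove j), ?_⟩
  have : Function.ExtendByZero.linearMap A i.succAbove
      (fun j => (w - (w i * ↑u⁻¹) • v) (i.succAbove j)) = w - (w i * ↑u⁻¹) • v := by
    ext j
    rw [Function.ExtendByZero.linearMap_apply]
    rcases Fin.eq_self_or_eq_succAbove i j with rfl | ⟨k, rfl⟩
    · rw [Function.extend_apply']
      · simp [← hu]
      · rintro ⟨k, hk⟩
        exact Fin.succAbove_ne _ _ hk
    · rw [Fin.succAbove_right_injective.extend_apply]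
  rw [LinearMap.comp_apply, this, map_sub, map_smul, hv, smul_zero, sub_zero]

/-- `ProjDimEq A p Y` describes finitely generated nonzero modules over a local ring with a minimal
free resolution of length `p`. -/
inductive ProjDimEq (A : Type u) [CommRing A] [IsLocalRing A] :
    ℕ → ∀ (Y : Type u) [AddCommGroup Y] [Module A Y], Prop
  | free (r : ℕ) (Y : Type u) [AddCommGroup Y] [Module A Y] :
      0 < r → ((Fin r → A) ≃ₗ[A] Y) → ProjDimEq A 0 Y
  | step (p r : ℕ) (L Y : Type u) [AddCommGroup L] [Module A L] [AddCommGroup Y] [Module A Y]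
      (f : L →ₗ[A] Fin r → A) (g : (Fin r → A) →ₗ[A] Y) :
      ProjDimEq A p L → (∀ x j, f x j ∈ maximalIdeal A) → IsSES f g → ProjDimEq A (p + 1) Y

theorem projDimEq_of_free [IsLocalRing A] [Nontrivial Y] [Module.Free A Y] [Module.Finite A Y] :
    ProjDimEq A 0 Y :=
  .free (Module.finrank A Y) Y (Module.finrank_pos_iff_of_free A Y |>.2 inferInstance)
    (Module.finBasis A Y).equivFun.symm

theorem ResolutionLE.exists_projDimEq [IsLocalRing A] [IsNoetherianRing A] {n : ℕ}
    (h : ResolutionLE A (fun X _ _ => Module.Projective A X) n Y) [Module.Finite A Y]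
    [Nontrivial Y] : ∃ p, ProjDimEq A p Y := by
  induction n generalizing Y with
  | zero =>
    cases h with
    | base _ h =>
      have : Module.Free A Y := Module.free_of_flat_of_isLocalRing
      exact ⟨0, projDimEq_of_free⟩
  | succ n ih =>
    obtain ⟨r, g, hg, hmin⟩ := exists_minimal_cover (A := A) (M := Y)
    have hs := IsSES.of_ker hg
    rcases subsingleton_or_nontrivial (LinearMap.ker g) with hL | hL
    · have e : (Fin r → A) ≃ₗ[A] Y := LinearEquiv.ofBijective g
        ⟨LinearMap.ker_eq_bot.1 (Submodule.subsingleton_iff_eq_bot.1 hL), hg⟩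
      have : Module.Free A Y := Module.Free.of_equiv e
      exact ⟨0, projDimEq_of_free⟩
    · obtain ⟨p, hp⟩ := ih (h.syzygy isResolving_projective hs)
      exact ⟨p + 1, .step p r _ Y _ _ hp (fun x j => hmin x.1 x.2 j) hs⟩

end Resolutions

section Free

variable {A : Type u} [CommRing A]
  {W : Type u} [AddCommGroup W] [Module A W]
  {M : Type u} [AddCommGroup M] [Module A M]

theorem extVanish_pi {n : ℕ} (h : ExtVanish A W M n) (r : ℕ) :
    ExtVanish A W (Fin r → M) n := by
  induction r with
  | zero =>
    exact extVanish_of_retract_right 0 0 (LinearMap.ext fun x => Subsingleton.elim _ _) h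
  | succ r ih =>
    refine IsSES.extVanish_right_mid (f := LinearMap.single A (fun _ : Fin (r + 1) => M) 0)
      (g := LinearMap.funLeft A M Fin.succ) ⟨fun x y hxy => by simpa using congrFun hxy 0, fun v => ?_, fun v => ?_⟩ h ih
    · constructor
      · intro hv
        refine ⟨v 0, ?_⟩
        ext i
        refine Fin.cases (by simp) (fun i => ?_) i
        have : v i.succ = 0 := congrFun hv i
        simp [this]
      · rintro ⟨x, rfl⟩
        ext i
        simp [LinearMap.funLeft_apply]
    · exact ⟨Fin.cons 0 v, by ext i; simp [LinearMap.funLeft_apply]⟩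

theorem extVanish_free [Nontrivial A] {n : ℕ} {F : Type u} [AddCommGroup F] [Module A F] [Module.Free A F]
    [Module.Finite A F] (h : ExtVanish A W A n) : ExtVanish A W F n :=
  (extVanish_pi h _).congr_right (Module.finBasis A F).equivFun.symm

end Free

/-! ### Depth through vanishing of Ext -/

/-- `DepthGE A n M` means that `Ext^i(k, M) = 0` for all `i < n`, where `k` is the residue
field of `A`. -/
def DepthGE (A : Type u) [CommRing A] [IsLocalRing A] (n : ℕ) (M : Type u) [AddCommGroup M]
    [Module A M] : Prop :=
  ∀ i < n, ExtVanish A (A ⧸ maximalIdeal A) M i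

/-- `HasDepth A n M` means that `n` is the least index with `Ext^n(k, M) ≠ 0`. -/
structure HasDepth (A : Type u) [CommRing A] [IsLocalRing A] (n : ℕ) (M : Type u)
    [AddCommGroup M] [Module A M] : Prop where
  ge : DepthGE A n M
  not_succ : ¬ DepthGE A (n + 1) M

section Depth

variable {A : Type u} [CommRing A] [IsLocalRing A]
  {W : Type u} [AddCommGroup W] [Module A W]
  {M : Type u} [AddCommGroup M] [Module A M]
  {X : Type u} [AddCommGroup X] [Module A X]
  {Y : Type u} [AddCommGroup Y] [Module A Y]
  {Z : Type u} [AddCommGroup Z] [Module A Z]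

theorem DepthGE.mono {m n : ℕ} (h : DepthGE A n X) (hmn : m ≤ n) : DepthGE A m X :=
  fun i hi => h i (hi.trans_le hmn)

theorem DepthGE.succ {n : ℕ} (h : DepthGE A n X)
    (h' : ExtVanish A (A ⧸ maximalIdeal A) X n) : DepthGE A (n + 1) X := by
  intro i hi
  rcases Nat.lt_succ_iff_lt_or_eq.1 hi with hi | rfl
  · exact h i hi
  · exact h'

theorem DepthGE.congr {n : ℕ} (e : X ≃ₗ[A] Y) (h : DepthGE A n X) : DepthGE A n Y :=
  fun i hi => (h i hi).congr_right e

theorem HasDepth.congr {n : ℕ} (e : X ≃ₗ[A] Y) (h : HasDepth A n X) : HasDepth A n Y :=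
  ⟨h.ge.congr e, fun h' => h.not_succ (h'.congr e.symm)⟩

theorem HasDepth.le_of_depthGE {m n : ℕ} (h : HasDepth A n X) (h' : DepthGE A m X) : m ≤ n := by
  by_contra hmn
  exact h.not_succ (h'.mono (by omega))

theorem HasDepth.unique {m n : ℕ} (h : HasDepth A n X) (h' : HasDepth A m X) : m = n :=
  le_antisymm (h.le_of_depthGE h'.ge) (h'.le_of_depthGE h.ge)

theorem maximalIdeal_smul_top_lt [Module.Finite A M] [Nontrivial M] :
    maximalIdeal A • (⊤ : Submodule A M) < ⊤ := by
  refine lt_top_iff_ne_top.2 fun h => ?_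
  have := Submodule.eq_bot_of_le_smul_of_le_jacobson_bot (maximalIdeal A) (⊤ : Submodule A M)
    Module.Finite.fg_top h.ge (IsLocalRing.maximalIdeal_le_jacobson _)
  exact top_ne_bot this

section Rees

variable [IsNoetherianRing A] [Module.Finite A M] [Nontrivial M]

theorem depthGE_iff_exists_isRegular {n : ℕ} :
    DepthGE A n M ↔ ∃ rs : List A, rs.length = n ∧ (∀ r ∈ rs, r ∈ maximalIdeal A) ∧
      RingTheory.Sequence.IsRegular M rs := by
  have hsupp : Module.support A (A ⧸ maximalIdeal A) =
      PrimeSpectrum.zeroLocus (maximalIdeal A : Set A) := by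
    rw [Module.support_eq_zeroLocus, Ideal.annihilator_quotient]
  constructor
  · intro h
    exact ModuleCat.exists_isRegular_of_exists_subsingleton_ext (maximalIdeal A) n
      (ModuleCat.of A M) maximalIdeal_smul_top_lt (ModuleCat.of A (A ⧸ maximalIdeal A)) hsupp h
  · rintro ⟨rs, rfl, hmem, hreg⟩
    exact ModuleCat.subsingleton_ext_of_exists_isRegular (maximalIdeal A)
      (ModuleCat.of A (A ⧸ maximalIdeal A)) hsupp.subset (ModuleCat.of A M)
      maximalIdeal_smul_top_lt rs hmem hreg

theorem DepthGE.le_ringKrullDim {n : ℕ} (h : DepthGE A n M) :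
    (n : WithBot ℕ∞) ≤ ringKrullDim A := by
  obtain ⟨rs, rfl, hmem, hreg⟩ := depthGE_iff_exists_isRegular.1 h
  have h1 := Module.supportDim_add_length_eq_supportDim_of_isRegular rs hreg
  have : Nontrivial (M ⧸ Ideal.ofList rs • (⊤ : Submodule A M)) :=
    Submodule.Quotient.nontrivial_iff.2 hreg.top_ne_smul.symm
  have h2 : 0 ≤ Module.supportDim A (M ⧸ Ideal.ofList rs • (⊤ : Submodule A M)) := by
    have := (Module.nonempty_support_of_nontrivial (R := A)
      (M := M ⧸ Ideal.ofList rs • (⊤ : Submodule A M))).to_subtype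
    exact Order.krullDim_nonneg
  calc ((rs.length : ℕ) : WithBot ℕ∞) = 0 + rs.length := by simp
    _ ≤ Module.supportDim A (M ⧸ Ideal.ofList rs • (⊤ : Submodule A M)) + rs.length := by gcongr
    _ = Module.supportDim A M := h1
    _ ≤ ringKrullDim A := Module.supportDim_le_ringKrullDim A M

theorem exists_hasDepth (A : Type u) [CommRing A] [IsLocalRing A] [IsNoetherianRing A]
    (M : Type u) [AddCommGroup M] [Module A M] [Module.Finite A M] [Nontrivial M] :
    ∃ n, HasDepth A n M ∧ moduleDepth A M = n := by
  classical
  have hex : ∃ n, ¬ DepthGE A (n + 1) M := by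
    obtain ⟨d, hd⟩ : ∃ d : ℕ, ringKrullDim A = d := by
      have h1 := ringKrullDim_ne_top (R := A)
      have h2 := ringKrullDim_nonneg_of_nontrivial (R := A)
      generalize ringKrullDim A = x at h1 h2
      induction x with
      | bot => exact absurd h2 (by simp)
      | coe x =>
        induction x with
        | top => exact absurd rfl h1
        | coe x => exact ⟨x, rfl⟩
    refine ⟨d, fun h => ?_⟩
    have := h.le_ringKrullDim
    rw [hd] at this
    exact absurd (by exact_mod_cast this) (Nat.not_succ_le_self d)
  have hn : HasDepth A (Nat.find hex) M := by
    refine ⟨?_, Nat.find_spec hex⟩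
    rcases h : Nat.find hex with _ | m
    · exact fun i hi => absurd hi (Nat.not_lt_zero i)
    · exact not_not.1 (Nat.find_min hex (m := m) (by omega))
  refine ⟨_, hn, le_antisymm (sSup_le ?_) (le_sSup ?_)⟩
  · rintro _ ⟨rs, rfl, hmem, hreg⟩
    exact_mod_cast hn.le_of_depthGE (depthGE_iff_exists_isRegular.2 ⟨rs, rfl, hmem, hreg⟩)
  · obtain ⟨rs, hl, hmem, hreg⟩ := depthGE_iff_exists_isRegular.1 hn.ge
    exact ⟨rs, by rw [hl], hmem, hreg⟩

end Rees

theorem comp_mk₀_eq_zero_of_mem_smul {θ : X →ₗ[A] Y}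
    (hθ : θ ∈ maximalIdeal A • (⊤ : Submodule A (X →ₗ[A] Y))) (n : ℕ)
    (x : Abelian.Ext (ModuleCat.of A (A ⧸ maximalIdeal A)) (ModuleCat.of A X) n) :
    x.comp (Abelian.Ext.mk₀ (ModuleCat.ofHom θ)) (add_zero n) = 0 := by
  refine Submodule.smul_induction_on (p := fun θ => x.comp
    (Abelian.Ext.mk₀ (ModuleCat.ofHom θ)) (add_zero n) = 0) hθ (fun r hr φ _ => ?_)
    fun φ ψ hφ hψ => ?_
  · have h1 : ModuleCat.ofHom (r • φ) = r • ModuleCat.ofHom φ := rfl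
    have h2 : r • 𝟙 (ModuleCat.of A (A ⧸ maximalIdeal A)) = 0 := by
      refine ModuleCat.hom_ext (LinearMap.ext fun y => ?_)
      obtain ⟨y, rfl⟩ := Ideal.Quotient.mk_surjective y
      change Ideal.Quotient.mk (maximalIdeal A) (r * y) = 0
      exact Ideal.Quotient.eq_zero_iff_mem.2 (Ideal.mul_mem_right _ _ hr)
    have h3 : r • x = 0 := by
      have : r • x = (Abelian.Ext.mk₀ (r • 𝟙 (ModuleCat.of A (A ⧸ maximalIdeal A)))).comp x
        (zero_add n) := by simp [Abelian.Ext.mk₀_smul]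
      rw [this, h2, Abelian.Ext.mk₀_zero, Abelian.Ext.zero_comp]
    rw [h1, Abelian.Ext.mk₀_smul, Abelian.Ext.comp_smul, ← Abelian.Ext.smul_comp, h3,
      Abelian.Ext.zero_comp]
  · have h1 : ModuleCat.ofHom (φ + ψ) = ModuleCat.ofHom φ + ModuleCat.ofHom ψ := rfl
    rw [h1, Abelian.Ext.mk₀_add, Abelian.Ext.comp_add, hφ, hψ, add_zero]

theorem mem_smul_top_of_forall_mem {r s : ℕ} {φ : (Fin r → A) →ₗ[A] (Fin s → A)}
    (h : ∀ x j, φ x j ∈ maximalIdeal A) :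
    φ ∈ maximalIdeal A • (⊤ : Submodule A ((Fin r → A) →ₗ[A] (Fin s → A))) := by
  classical
  have : φ = ∑ i, ∑ j, φ (Pi.single i 1) j •
      (LinearMap.single A (fun _ => A) j ∘ₗ LinearMap.proj i) := by
    refine LinearMap.pi_ext' fun i => LinearMap.ext_ring ?_
    ext j
    simp [Finset.sum_apply, Pi.single_apply]
  rw [this]
  exact Submodule.sum_mem _ fun i _ => Submodule.sum_mem _ fun j _ =>
    Submodule.smul_mem_smul (h _ _) trivial

theorem DepthGE.pi {n : ℕ} (h : DepthGE A n M) (r : ℕ) : DepthGE A n (Fin r → M) :=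
  fun i hi => extVanish_pi (h i hi) r

theorem HasDepth.pi {n r : ℕ} (h : HasDepth A n M) (hr : 0 < r) : HasDepth A n (Fin r → M) := by
  refine ⟨h.ge.pi r, fun h' => h.not_succ fun i hi => ?_⟩
  refine extVanish_of_retract_right (LinearMap.single A (fun _ : Fin r => M) ⟨0, hr⟩)
    (LinearMap.proj ⟨0, hr⟩) ?_ (h' i hi)
  ext x
  simp

/-- Tensoring a module with a free module of rank `r`. -/
def piTensorEquiv (A : Type u) [CommRing A] (M : Type u) [AddCommGroup M] [Module A M] (r : ℕ) :
    TensorProduct A (Fin r → A) M ≃ₗ[A] (Fin r → M) :=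
  (TensorProduct.comm A _ _).trans (TensorProduct.piScalarRight A A M (Fin r))

theorem HasDepth.of_ses {f : X →ₗ[A] Y} {g : Y →ₗ[A] Z} (h : IsSES f g) {s : ℕ}
    (hX : HasDepth A s X) (hY : DepthGE A s Y)
    (hf : ∀ x : Abelian.Ext (ModuleCat.of A (A ⧸ maximalIdeal A)) (ModuleCat.of A X) s,
      x.comp (Abelian.Ext.mk₀ (ModuleCat.ofHom f)) (add_zero s) = 0) :
    ∃ s', s' + 1 = s ∧ HasDepth A s' Z := by
  cases s with
  | zero => exact (hX.not_succ (hX.ge.succ (h.extVanish_right_first_zero_of_map hf))).elim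
  | succ s =>
    refine ⟨s, rfl, fun i hi => ?_, fun hZ => ?_⟩
    · exact h.extVanish_right_last (hY i (hi.trans s.lt_succ_self))
        (hX.ge (i + 1) (Nat.succ_lt_succ hi))
    · exact hX.not_succ (hX.ge.succ (h.extVanish_right_first_of_map (hZ s s.lt_succ_self) hf))

theorem DepthGE.mid {f : X →ₗ[A] Y} {g : Y →ₗ[A] Z} (h : IsSES f g) {s : ℕ}
    (hX : DepthGE A s X) (hZ : DepthGE A s Z) : DepthGE A s Y :=
  fun i hi => h.extVanish_right_mid (hX i hi) (hZ i hi)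

theorem DepthGE.first {f : X →ₗ[A] Y} {g : Y →ₗ[A] Z} (h : IsSES f g) {s : ℕ}
    (hY : DepthGE A (s + 1) Y) (hZ : DepthGE A s Z) : DepthGE A (s + 1) X := by
  intro i hi
  cases i with
  | zero =>
    have := hY 0 hi
    exact h.extVanish_right_first_zero_of_map fun x => this.elim _ _
  | succ i => exact h.extVanish_right_first (hZ i (Nat.lt_of_succ_lt_succ hi)) (hY (i + 1) hi)

theorem DepthGE.first' {f : X →ₗ[A] Y} {g : Y →ₗ[A] Z} (h : IsSES f g) {s : ℕ}
    (hY : DepthGE A s Y) (hZ : DepthGE A s Z) : DepthGE A s X := by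
  cases s with
  | zero => exact fun i hi => absurd hi (Nat.not_lt_zero i)
  | succ s => exact hY.first h (hZ.mono s.le_succ)

/-- The Auslander–Buchsbaum formula for a tensor product with a Tor-independent module of finite
projective dimension. -/
theorem ProjDimEq.hasDepth_tensor {p : ℕ} (hY : ProjDimEq A p Y) (hT : TorVanish A Y M) {e : ℕ}
    (hM : HasDepth A e M) : ∃ s, s + p = e ∧ HasDepth A s (TensorProduct A Y M) := by
  induction hY with
  | free r Y hr e' =>
    exact ⟨e, rfl, (hM.pi hr).congr
      ((piTensorEquiv A M r).symm.trans (TensorProduct.congr e' (LinearEquiv.refl A M)))⟩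
  | step p r L Y f g hL hmin hs ih =>
    obtain ⟨s, hsp, hd⟩ := ih (hT.of_ses_left hs)
    have hs' := hs.rTensor (hT 0)
    have hF : DepthGE A e (TensorProduct A (Fin r → A) M) :=
      (hM.ge.pi r).congr (piTensorEquiv A M r).symm
    obtain ⟨s', hs1, hs2⟩ := hd.of_ses hs' (hF.mono (by omega)) fun x => by
      cases hL with
      | free r' _ hr' e' =>
        have h1 := mem_smul_top_of_forall_mem (φ := f ∘ₗ e'.toLinearMap) fun x j => hmin _ _
        have h2 := Submodule.smul_top_le_comap_smul_top (maximalIdeal A)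
          (LinearMap.rTensorHom M ∘ₗ LinearMap.lcomp A (Fin r → A) e'.symm.toLinearMap) h1
        have h3 : (LinearMap.rTensorHom M ∘ₗ LinearMap.lcomp A (Fin r → A) e'.symm.toLinearMap)
            (f ∘ₗ e'.toLinearMap) = f.rTensor M := by
          change LinearMap.rTensor M ((f ∘ₗ e'.toLinearMap) ∘ₗ e'.symm.toLinearMap) = _
          congr 1
          ext x j
          simp
        rw [Submodule.mem_comap, h3] at h2
        exact comp_mk₀_eq_zero_of_mem_smul h2 s x
      | step p _ _ _ _ _ _ _ _ => exact (hF s (by omega)).elim _ _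
    exact ⟨s', by omega, hs2⟩

/-- The Auslander–Buchsbaum formula. -/
theorem ProjDimEq.hasDepth {p : ℕ} (hY : ProjDimEq A p Y) {d : ℕ} (hA : HasDepth A d A) :
    ∃ s, s + p = d ∧ HasDepth A s Y := by
  obtain ⟨s, h1, h2⟩ := hY.hasDepth_tensor TorVanish.of_flat_right hA
  exact ⟨s, h1, h2.congr (TensorProduct.rid A Y)⟩

end Depth

/-! ### Modules of reducible complexity and vanishing of Ext -/

section Reducible

variable {A : Type u} [CommRing A] [IsLocalRing A]
  {M : Type u} [AddCommGroup M] [Module A M]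
  {N : Type u} [AddCommGroup N] [Module A N]
  {S : Type u} [AddCommGroup S] [Module A S]
  {W : Type u} [AddCommGroup W] [Module A W]
  {X : Type u} [AddCommGroup X] [Module A X]
  {Y : Type u} [AddCommGroup Y] [Module A Y]

theorem IsSyzygy.induction {C : ℕ → ∀ (X : Type u) [AddCommGroup X] [Module A X], Prop}
    (congr : ∀ (n : ℕ) {X Y : Type u} [AddCommGroup X] [Module A X] [AddCommGroup Y] [Module A Y],
      (X ≃ₗ[A] Y) → C n X → C n Y)
    (step : ∀ (n : ℕ) {L F X : Type u} [AddCommGroup L] [Module A L] [AddCommGroup F] [Module A F]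
      [AddCommGroup X] [Module A X] [Module.Free A F] [Module.Finite A F] {f : L →ₗ[A] F}
      {g : F →ₗ[A] X}, IsSES f g → C n X → C (n + 1) L)
    (zero : C 0 M) {n : ℕ} (h : IsSyzygy A M S n) : C n S := by
  cases n with
  | zero =>
    obtain ⟨e⟩ := h
    exact congr 0 e.symm zero
  | succ n =>
    obtain ⟨R, ⟨e⟩⟩ := h
    refine congr _ e.symm ?_
    have := R.free
    have := R.fin
    clear e
    induction n with
    | zero =>
      exact step 0 (congr_ses R.aug_surj R.exact_aug) zero
    | succ n ih =>
      refine step (n + 1) (f := (LinearMap.range (R.d (n + 1))).subtype)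
        (g := (R.d n).rangeRestrict) ⟨Subtype.val_injective, fun y => ?_, ?_⟩ ih
      · simp [Subtype.ext_iff, R.exact_d n y]
      · exact LinearMap.surjective_rangeRestrict _
where congr_ses {L F M : Type u} [AddCommGroup L] [Module A L] [AddCommGroup F] [Module A F]
    [AddCommGroup M] [Module A M] {f : L →ₗ[A] F} {g : F →ₗ[A] M} (hg : Function.Surjective g)
    (h : Function.Exact f g) : IsSES (LinearMap.range f).subtype g :=
  ⟨Subtype.val_injective, fun y => by simp [h y], hg⟩

theorem IsSyzygy.finite [IsNoetherianRing A] [Module.Finite A M] {n : ℕ} (h : IsSyzygy A M S n) :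
    Module.Finite A S :=
  h.induction (C := fun _ X _ _ => Module.Finite A X) (fun _ _ _ _ _ _ _ e _ => .equiv e)
    (fun _ _ _ _ _ _ _ _ _ _ _ _ _ _ hs _ => hs.finite_left) ‹_›

theorem IsSyzygy.torVanish {n : ℕ} (h : IsSyzygy A M S n) (hT : TorVanish A M N) :
    TorVanish A S N :=
  h.induction (C := fun _ X _ _ => TorVanish A X N)
    (fun _ _ _ _ _ _ _ e h n => (h n).congr_left e)
    (fun _ _ _ _ _ _ _ _ _ _ _ _ _ _ hs hT => hT.of_ses_left hs) hT

theorem DepthGE.free {F : Type u} [AddCommGroup F] [Module A F] [Module.Free A F]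
    [Module.Finite A F] {n : ℕ} (h : DepthGE A n A) : DepthGE A n F :=
  fun i hi => extVanish_free (h i hi)

theorem DepthGE.tensor_free {F : Type u} [AddCommGroup F] [Module A F] [Module.Free A F]
    [Module.Finite A F] {n : ℕ} (h : DepthGE A n M) : DepthGE A n (TensorProduct A F M) :=
  (h.pi _).congr ((piTensorEquiv A M _).symm.trans
    (TensorProduct.congr (Module.finBasis A F).equivFun.symm (LinearEquiv.refl A M)))

theorem IsSyzygy.depthGE {n m : ℕ} (h : IsSyzygy A M S n) (hA : DepthGE A m A)
    (hM : DepthGE A m M) : DepthGE A m S :=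
  h.induction (C := fun _ X _ _ => DepthGE A m X)
    (fun _ _ _ _ _ _ _ e h => h.congr e)
    (fun _ _ _ _ _ _ _ _ _ _ _ _ _ _ hs hX => hA.free.first' hs hX) hM

theorem IsSyzygy.depthGE_tensor {n m : ℕ} (h : IsSyzygy A M S n) (hT : TorVanish A M N)
    (hN : DepthGE A m N) (hM : DepthGE A m (TensorProduct A M N)) :
    DepthGE A m (TensorProduct A S N) :=
  (h.induction (C := fun _ X _ _ => TorVanish A X N ∧ DepthGE A m (TensorProduct A X N))
    (fun _ _ _ _ _ _ _ e h => ⟨fun n => (h.1 n).congr_left e,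
      h.2.congr (TensorProduct.congr e (LinearEquiv.refl A N))⟩)
    (fun _ _ _ _ _ _ _ _ _ _ _ _ _ _ hs hX => ⟨hX.1.of_ses_left hs,
      hN.tensor_free.first' (hs.rTensor (hX.1 0)) hX.2⟩) ⟨hT, hM⟩).2

theorem IsSyzygy.extVanish {n : ℕ} (h : IsSyzygy A M S n) {i : ℕ}
    (hM : ExtVanish A M W (i + 1 + n)) : ExtVanish A S W (i + 1) :=
  h.induction (C := fun n X _ _ => ∀ i, ExtVanish A M W (i + 1 + n) → ExtVanish A X W (i + 1))
    (fun _ _ _ _ _ _ _ e h i hi => (h i hi).congr_left e)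
    (fun n _ _ _ _ _ _ _ _ _ _ _ _ _ hs hX i hi => hs.extVanish_left_first
      (extVanish_of_projective i) (hX (i + 1) (by convert hi using 1; ring))) (fun _ h => h) i hM

theorem HasRedCxCat.extVanish_of_eventually [IsNoetherianRing A] {d : ℕ} (hA : HasDepth A d A)
    {M : ModuleCat.{u} A} (h : HasRedCxCat A M) [hfin : Module.Finite A M] [hnt : Nontrivial M]
    (hM : DepthGE A d M) {b : ℕ} (hW : ∀ i, b ≤ i → ExtVanish A M W (i + 1)) (i : ℕ) :
    ExtVanish A M W (i + 1) := by
  induction h generalizing hfin hnt b i with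
  | of_finite_pd M hpd =>
    obtain ⟨n, hn⟩ := hpd.resolutionLE
    obtain ⟨p, hp⟩ := hn.exists_projDimEq
    obtain ⟨s, hs, hMs⟩ := hp.hasDepth hA
    have := hMs.le_of_depthGE hM
    obtain rfl : p = 0 := by omega
    cases hp with
    | free r _ _ e =>
      have := Module.Projective.of_equiv e
      exact extVanish_of_projective i
  | of_step M K t _ _ hK _ _ ih =>
    obtain ⟨ht, S, _, _, hS, f, g, hf, hg, hfg⟩ := hK
    have hs : IsSES f g := ⟨hf, hfg, hg⟩
    have := hS.finite
    have := hs.finite_mid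
    have := hf.nontrivial
    have hKW := ih (hM.mid hs (hS.depthGE hA.ge hM)) (b := b) fun i hi =>
      hs.extVanish_left_mid (hW i hi) (hS.extVanish (hW (i + (t - 1)) (by omega) |> fun h => by
        convert h using 1; ring))
    clear ih
    induction b generalizing i with
    | zero => exact hW i i.zero_le
    | succ b ih =>
      refine ih (fun j hj => hs.extVanish_left_first (hKW j) (hS.extVanish ?_)) i
      convert hW (j + 1 + (t - 1)) (by omega) using 1
      ring

end Reducible

/-! ### Finite projective hulls -/

section Hull

variable {A : Type u} [CommRing A]
  {L : Type u} [AddCommGroup L] [Module A L]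
  {F : Type u} [AddCommGroup F] [Module A F]
  {F' : Type u} [AddCommGroup F'] [Module A F']
  {M : Type u} [AddCommGroup M] [Module A M]
  {N : Type u} [AddCommGroup N] [Module A N]
  {X : Type u} [AddCommGroup X] [Module A X]
  {X' : Type u} [AddCommGroup X'] [Module A X']
  {Y : Type u} [AddCommGroup Y] [Module A Y]

theorem IsSES.exists_cokernel_prod {i : L →ₗ[A] F} {g : F →ₗ[A] N} (h₁ : IsSES i g)
    {f : L →ₗ[A] Y} {q : Y →ₗ[A] X} (h₂ : IsSES f q) {j : X →ₗ[A] F'} {π : F' →ₗ[A] X'}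
    (h₃ : IsSES j π) {h : Y →ₗ[A] F} (hh : h ∘ₗ f = i) :
    ∃ (Z : Type u) (_ : AddCommGroup Z) (_ : Module A Z) (a : Y →ₗ[A] F × F')
      (b : F × F' →ₗ[A] Z) (c : N →ₗ[A] Z) (e : Z →ₗ[A] X'), IsSES a b ∧ IsSES c e := by
  have hh' (l : L) : h (f l) = i l := LinearMap.congr_fun hh l
  have hker (y : Y) (hy : q y = 0) : ∃ l, f l = y := (h₂.exact y).1 hy
  have ha : Function.Injective (h.prod (j ∘ₗ q)) := by
    rw [injective_iff_map_eq_zero]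
    intro y hy
    obtain ⟨hy₁, hy₂⟩ : h y = 0 ∧ j (q y) = 0 := Prod.mk.inj hy
    obtain ⟨l, rfl⟩ := hker y (h₃.inj (by rw [hy₂, map_zero]))
    rw [hh'] at hy₁
    rw [h₁.inj (hy₁.trans (map_zero i).symm), map_zero]
  have hc : LinearMap.ker g ≤ LinearMap.ker
      ((LinearMap.range (h.prod (j ∘ₗ q))).mkQ ∘ₗ LinearMap.inl A F F') := by
    intro x hx
    obtain ⟨l, rfl⟩ := (h₁.exact x).1 hx
    simp only [LinearMap.mem_ker, LinearMap.comp_apply, Submodule.mkQ_apply,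
      Submodule.Quotient.mk_eq_zero]
    exact ⟨f l, by simp [hh', h₂.exact.apply_apply_eq_zero]⟩
  have he : LinearMap.range (h.prod (j ∘ₗ q)) ≤ LinearMap.ker (π ∘ₗ LinearMap.snd A F F') := by
    rintro _ ⟨y, rfl⟩
    simp [h₃.exact.apply_apply_eq_zero]
  let c : N →ₗ[A] _ := (LinearMap.ker g).liftQ _ hc ∘ₗ
    (g.quotKerEquivOfSurjective h₁.surj).symm.toLinearMap
  have hcg (x : F) : c (g x) = (LinearMap.range (h.prod (j ∘ₗ q))).mkQ (x, 0) := by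
    have : (g.quotKerEquivOfSurjective h₁.surj).symm (g x) = (LinearMap.ker g).mkQ x := by
      rw [LinearEquiv.symm_apply_eq]
      rfl
    simp [c, this]
  refine ⟨_, _, _, h.prod (j ∘ₗ q), _, c, (LinearMap.range _).liftQ _ he, IsSES.of_range ha,
    ?_, fun z => ?_, fun x => ?_⟩
  · rw [injective_iff_map_eq_zero]
    intro n hn
    obtain ⟨x, rfl⟩ := h₁.surj n
    rw [hcg, Submodule.mkQ_apply, Submodule.Quotient.mk_eq_zero] at hn
    obtain ⟨y, hy⟩ := hn
    obtain ⟨hy₁, hy₂⟩ : h y = x ∧ j (q y) = 0 := Prod.mk.inj hy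
    obtain ⟨l, rfl⟩ := hker y (h₃.inj (by rw [hy₂, map_zero]))
    rw [← hy₁, hh', h₁.exact.apply_apply_eq_zero]
  · obtain ⟨⟨x, v⟩, rfl⟩ := Submodule.mkQ_surjective _ z
    constructor
    · intro hz
      obtain ⟨w, rfl⟩ := (h₃.exact v).1 hz
      obtain ⟨y, rfl⟩ := h₂.surj w
      refine ⟨g (x - h y), ?_⟩
      rw [hcg, ← sub_eq_zero, ← map_sub, Submodule.mkQ_apply, Submodule.Quotient.mk_eq_zero]
      exact ⟨-y, by simp⟩
    · rintro ⟨n, hn⟩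
      obtain ⟨x', rfl⟩ := h₁.surj n
      rw [← hn, hcg]
      simp
  · obtain ⟨v, rfl⟩ := h₃.surj x
    exact ⟨(LinearMap.range _).mkQ (0, v), rfl⟩

/-- A finitely generated module of finite Gorenstein dimension embeds in a module of finite
projective dimension with totally reflexive cokernel. -/
theorem ResolutionLE.exists_hull [IsLocalRing A] [IsNoetherianRing A] {n : ℕ}
    (h : ResolutionLE A (TotRefl A) n N) [Module.Finite A N] :
    ∃ (Y X : Type u) (_ : AddCommGroup Y) (_ : Module A Y) (_ : AddCommGroup X)
      (_ : Module A X) (f : N →ₗ[A] Y) (g : Y →ₗ[A] X) (k : ℕ), Module.Finite A X ∧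
      ResolutionLE A (fun X _ _ => Module.Projective A X) k Y ∧ TotRefl A X ∧ IsSES f g := by
  induction n generalizing N with
  | zero =>
    cases h with
    | base _ h =>
      obtain ⟨F, X, _, _, _, _, f, g, _, _, _, hX, hs⟩ := h.exists_embedding
      exact ⟨F, X, _, _, _, _, f, g, 0, inferInstance, .base F inferInstance, hX, hs⟩
  | succ n ih =>
    obtain ⟨r, g, hg, -⟩ := exists_minimal_cover (A := A) (M := N)
    have hs := IsSES.of_ker hg
    have := hs.finite_left
    obtain ⟨Y, X, _, _, _, _, f, q, k, _, hY, hX, hs₂⟩ := ih (h.syzygy isResolving_totRefl hs)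
    obtain ⟨F', X', _, _, _, _, j, π, _, _, _, hX', hs₃⟩ := hX.exists_embedding
    obtain ⟨ψ, hψ⟩ := hs₂.exists_extension (LinearMap.ker g).subtype (extVanish_free (hX.ext 0))
    obtain ⟨Z, _, _, a, b, c, e, hab, hce⟩ := hs.exists_cokernel_prod hs₂ hs₃ hψ
    have : Module.Projective A ((Fin r → A) × F') := inferInstance
    exact ⟨Z, X', _, _, _, _, c, e, k + 1, inferInstance, .step k Y _ Z a b this hY hab, hX', hce⟩

theorem ResolutionLE.extVanish_character {k : ℕ}
    (h : ResolutionLE A (fun X _ _ => Module.Projective A X) k Y) {i : ℕ} (hi : k ≤ i) :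
    ExtVanish A M (CharacterModule Y) (i + 1) := by
  induction h generalizing i with
  | base Y hY => exact extVanish_character_of_flat i
  | step k K G Y f g hG hK hs ih =>
    obtain ⟨i, rfl⟩ : ∃ i', i = i' + 1 := ⟨i - 1, by omega⟩
    exact hs.dual.extVanish_right_first (ih (by omega)) (extVanish_character_of_flat _)

end Hull

/-! ### The depth formula -/

/-- If the groups `Ext^i(M, W)` vanish for all large `i`, then they vanish for all `i > 0`. -/
def ExtPersistent (A : Type u) [CommRing A] (M : Type u) [AddCommGroup M] [Module A M] : Prop :=
  ∀ (W : Type u) [AddCommGroup W] [Module A W] (b : ℕ),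
    (∀ i, b ≤ i → ExtVanish A M W (i + 1)) → ∀ i, ExtVanish A M W (i + 1)

theorem nontrivial_tensorProduct {A : Type u} [CommRing A] [IsLocalRing A]
    {M : Type u} [AddCommGroup M] [Module A M] {N : Type u} [AddCommGroup N] [Module A N]
    [Module.Finite A M] [Nontrivial M] [Module.Finite A N]
    [Nontrivial N] : Nontrivial (TensorProduct A M N) := by
  rw [← not_subsingleton_iff_nontrivial]
  intro h
  have hM : Nontrivial (TensorProduct A (ResidueField A) M) := by
    rwa [← not_subsingleton_iff_nontrivial, subsingleton_tensorProduct,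
      not_subsingleton_iff_nontrivial]
  have hN : Nontrivial (TensorProduct A (ResidueField A) N) := by
    rwa [← not_subsingleton_iff_nontrivial, subsingleton_tensorProduct,
      not_subsingleton_iff_nontrivial]
  have h1 : Nontrivial (TensorProduct (ResidueField A) (TensorProduct A (ResidueField A) M)
    (TensorProduct A (ResidueField A) N)) := inferInstance
  exact not_subsingleton _ (TensorProduct.AlgebraTensorModule.distribBaseChange A
    (ResidueField A) M N).symm.toEquiv.subsingleton

section DepthFormula

variable {A : Type u} [CommRing A] [IsLocalRing A] [IsNoetherianRing A]
  {M : Type u} [AddCommGroup M] [Module A M]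
  {N : Type u} [AddCommGroup N] [Module A N]
  {X : Type u} [AddCommGroup X] [Module A X]

theorem TotRefl.depthGE_tensor (hP : ExtPersistent A M) {d : ℕ} (hM : DepthGE A d M)
    [Module.Finite A X] (hX : TotRefl A X) {b : ℕ}
    (hMX : ∀ i, b ≤ i → ExtVanish A M (CharacterModule X) (i + 1)) {n : ℕ} (hn : n ≤ d) :
    DepthGE A n (TensorProduct A M X) := by
  induction n generalizing X b with
  | zero => exact fun i hi => absurd hi i.not_lt_zero
  | succ n ih =>
    obtain ⟨F, X', _, _, _, _, f, g, _, _, _, hX', hs⟩ := hX.exists_embedding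
    have hMX' : ∀ i, b + 1 ≤ i → ExtVanish A M (CharacterModule X') (i + 1) := by
      intro i hi
      obtain ⟨i, rfl⟩ : ∃ i', i = i' + 1 := ⟨i - 1, by omega⟩
      exact hs.dual.extVanish_right_first (hMX i (by omega)) (extVanish_character_of_flat _)
    have hF : DepthGE A (n + 1) (TensorProduct A M F) :=
      ((hM.mono hn).tensor_free (F := F)).congr (TensorProduct.comm A F M)
    exact hF.first (hs.lTensor (hP _ _ hMX' 0)) (ih hX' hMX' (by omega))

theorem TotRefl.depthGE {d : ℕ} (hA : DepthGE A d A) [Module.Finite A X] (hX : TotRefl A X) :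
    DepthGE A d X :=
  (hX.depthGE_tensor (M := A) (fun _ _ _ _ _ i => extVanish_of_projective i) hA (b := 0)
    (fun i _ => extVanish_of_projective i) le_rfl).congr (TensorProduct.lid A X)

theorem not_depthGE_tensor_of_extPersistent {d : ℕ} (hA : HasDepth A d A)
    (hM : HasDepth A d M) (hP : ExtPersistent A M) [Module.Finite A N] [Nontrivial N] {n : ℕ}
    (hN : ResolutionLE A (TotRefl A) n N) (hT : TorVanish A M N) {e : ℕ} (he : HasDepth A e N)
    (hed : e < d) : ¬ DepthGE A (e + 1) (TensorProduct A M N) := by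
  intro hMN
  obtain ⟨Y, X, _, _, _, _, f, g, k, _, hY, hX, hs⟩ := hN.exists_hull
  have hMY := hP _ k fun i hi => hY.extVanish_character hi
  have hMX : ∀ i, k + 1 ≤ i → ExtVanish A M (CharacterModule X) (i + 1) := by
    intro i hi
    obtain ⟨i, rfl⟩ : ∃ i', i = i' + 1 := ⟨i - 1, by omega⟩
    exact hs.dual.extVanish_right_first (hT i) (hMY _)
  have hMY' : DepthGE A (e + 1) (TensorProduct A M Y) :=
    hMN.mid (hs.lTensor (hP _ _ hMX 0)) (hX.depthGE_tensor hP hM.ge hMX hed)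
  have := hs.finite_mid
  have := hs.inj.nontrivial
  obtain ⟨p, hp⟩ := hY.exists_projDimEq
  obtain ⟨s, hsp, hYs⟩ := hp.hasDepth hA
  obtain ⟨s', hsp', hYM⟩ := hp.hasDepth_tensor (TorVanish.symm hMY) hM
  have h1 := hYM.le_of_depthGE (hMY'.congr (TensorProduct.comm A M Y))
  exact he.not_succ ((hYs.ge.mono (by omega : e + 1 ≤ s)).first hs
    ((hX.depthGE hA.ge).mono hed.le))

theorem HasRedCxCat.depth_formula {d : ℕ} (hA : HasDepth A d A) (hd : ringKrullDim A = d)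
    [Module.Finite A N] [Nontrivial N] {n : ℕ} (hN : ResolutionLE A (TotRefl A) n N)
    {M : ModuleCat.{u} A} (h : HasRedCxCat A M) [hfin : Module.Finite A M] [hnt : Nontrivial M]
    (hT : TorVanish A M N) {m e s : ℕ} (hm : HasDepth A m M) (he : HasDepth A e N)
    (hs : HasDepth A s (TensorProduct A M N)) : m + e = d + s := by
  induction h generalizing hfin hnt m s with
  | of_finite_pd M hpd =>
    obtain ⟨n, hn⟩ := hpd.resolutionLE
    obtain ⟨p, hp⟩ := hn.exists_projDimEq
    obtain ⟨m', h1, h2⟩ := hp.hasDepth hA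
    obtain ⟨s', h3, h4⟩ := hp.hasDepth_tensor hT he
    have := h2.unique hm
    have := h4.unique hs
    omega
  | of_step M K t hc hc' hK hlt hKred ih =>
    have hred := HasRedCxCat.of_step M K t hc hc' hK hlt hKred
    have le_d {Z : Type u} [AddCommGroup Z] [Module A Z] [Module.Finite A Z] [Nontrivial Z]
        {z : ℕ} (hz : HasDepth A z Z) : z ≤ d := by
      have := hz.ge.le_ringKrullDim
      rw [hd] at this
      exact_mod_cast this
    obtain ⟨-, S, _, _, hS, f, g, hf, hg, hfg⟩ := hK
    have hses : IsSES f g := ⟨hf, hfg, hg⟩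
    have := hS.finite
    have := hses.finite_mid
    have := hf.nontrivial
    have hmd := le_d hm
    have hSm := hS.depthGE (hA.ge.mono hmd) hm.ge
    have hTS := hS.torVanish hT
    have hTK : TorVanish A K N := fun n => hses.extVanish_left_mid (hT n) (hTS n)
    have hmK : HasDepth A m K :=
      ⟨hm.ge.mid hses hSm, fun h => hm.not_succ (h.first hses hSm)⟩
    have hses' := hses.rTensor (hTS 0)
    by_cases hse : s ≤ e
    · have hSs := hS.depthGE_tensor hT (he.ge.mono hse) hs.ge
      exact ih hTK hmK ⟨hs.ge.mid hses' hSs, fun h => hs.not_succ (h.first hses' hSs)⟩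
    · push Not at hse
      have hSe := hS.depthGE_tensor hT he.ge (hs.ge.mono hse.le)
      have := nontrivial_tensorProduct (A := A) (M := K) (N := N)
      obtain ⟨k, hk, -⟩ := exists_hasDepth A (TensorProduct A K N)
      have hek := hk.le_of_depthGE ((hs.ge.mono hse.le).mid hses' hSe)
      have := ih hTK hmK hk
      obtain rfl : m = d := by omega
      have := nontrivial_tensorProduct (A := A) (M := M) (N := N)
      have := le_d hs
      exact (not_depthGE_tensor_of_extPersistent hA hm
        (fun W _ _ b hW => hred.extVanish_of_eventually hA hm.ge hW) hN hT he (by omega)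
        (hs.ge.mono hse)).elim

end DepthFormula

/-- **Depth formula - Gorenstein case 1 (Theorem 3.3).** Let `A` be a Cohen-Macaulay
local ring and `M`, `N` nonzero finitely generated Tor-independent `A`-modules. If `M`
has reducible complexity and `N` has finite Gorenstein dimension, then
`depth M + depth N = dim A + depth (M ⊗ N)`. -/
theorem depth_formula_gorenstein_case_one (A : Type u) [CommRing A] [IsNoetherianRing A]
    [IsLocalRing A] (hCM : IsCMLocalRing A)
    (M N : Type u) [AddCommGroup M] [Module A M] [AddCommGroup N] [Module A N]
    [Module.Finite A M] [Module.Finite A N]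
    (hM : Nontrivial M) (hN : Nontrivial N)
    (hTor : TorIndep A M N)
    (hred : HasReducibleComplexity A M)
    (hGdim : HasFiniteGDim A N) :
    (moduleDepth A M : WithBot ℕ∞) + (moduleDepth A N : WithBot ℕ∞) =
      ringKrullDimE A + (moduleDepth A (TensorProduct A M N) : WithBot ℕ∞) := by
  have hMN := nontrivial_tensorProduct (A := A) (M := M) (N := N)
  obtain ⟨d, hd, hAd⟩ := exists_hasDepth A A
  obtain ⟨m, hm, hMm⟩ := exists_hasDepth A M
  obtain ⟨e, he, hNe⟩ := exists_hasDepth A N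
  obtain ⟨s, hs, hMNs⟩ := exists_hasDepth A (TensorProduct A M N)
  obtain ⟨n, hn⟩ := hGdim.resolutionLE
  have hdim : ringKrullDim A = d := by
    have h : (moduleDepth A A : WithBot ℕ∞) = ringKrullDim A := hCM
    rw [← h, hAd]
    rfl
  have key : m + e = d + s := hred.depth_formula hd hdim hn hTor.torVanish hm he hs
  rw [hMm, hNe, hMNs, ringKrullDimE, hdim]
  exact_mod_cast key
end
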